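/- (Isospectral domains with mixed Dirichlet–Neumann boundary conditions) Let Ω₁ = (0,1) × (0,1) be the open unit square with Dirichlet part Γ_D¹ consisting of its left, bottom and right sides ({0}×[0,1]) ∪ ([0,1]×{0}) ∪ ({1}×[0,1]) (Neumann part the top side), and let Ω₂ be the open right isosceles triangle with vertices (0,0), (√2,0), (0,√2), with Dirichlet part Γ_D² consisting of the hypotenuse (the segment from (√2,0) to (0,√2)) and the vertical leg (the segment from (0,0) to (0,√2)) (Neumann part the bottom leg). Then λ_k^{mix}(Ω₁, Γ_D¹) = λ_k^{mix}(Ω₂, Γ_D²) for every integer k ≥ 1; i.e., the two mixed Dirichlet–Neumann eigenvalue problems for the Laplacian are isospectral. -/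

import Mathlib

open MeasureTheory Real

/-- The k-th mixed Dirichlet–Neumann eigenvalue of the Laplacian on `Ω ⊆ ℝ²` with Dirichlet
part `ΓD ⊆ ∂Ω`, defined variationally as the infimum, over all `k`-dimensional subspaces `E`
of the space of restrictions to `Ω` of smooth functions on ℝ² vanishing on a neighborhood of
`ΓD`, of the supremum of the Rayleigh quotient `(∫_Ω ‖∇u‖²) / (∫_Ω u²)` over nonzero `u ∈ E`.
A subspace of restrictions is encoded as a subspace of smooth functions on ℝ² on which the
restriction map to `Ω` is injective. -/
noncomputable def mixedEig (Ω ΓD : Set (EuclideanSpace ℝ (Fin 2))) (k : ℕ) : ℝ :=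
  sInf { r : ℝ | ∃ E : Submodule ℝ (EuclideanSpace ℝ (Fin 2) → ℝ),
    Module.finrank ℝ E = k ∧
    (∀ u ∈ E, ContDiff ℝ (⊤ : ℕ∞) u ∧
      ∃ V : Set (EuclideanSpace ℝ (Fin 2)), IsOpen V ∧ ΓD ⊆ V ∧ Set.EqOn u 0 V) ∧
    (∀ u ∈ E, Set.EqOn u 0 Ω → u = 0) ∧
    r = sSup { q : ℝ | ∃ u ∈ E, u ≠ (0 : EuclideanSpace ℝ (Fin 2) → ℝ) ∧
        q = (∫ x in Ω, ‖gradient u x‖ ^ 2) / (∫ x in Ω, (u x) ^ 2) } }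

/-- The point `(a, b)` of the Euclidean plane. -/
noncomputable def pt (a b : ℝ) : EuclideanSpace ℝ (Fin 2) :=
  (WithLp.equiv 2 (Fin 2 → ℝ)).symm ![a, b]

/-- The open unit square `(0,1) × (0,1)`. -/
def unitSquare : Set (EuclideanSpace ℝ (Fin 2)) :=
  {x | x 0 ∈ Set.Ioo (0 : ℝ) 1 ∧ x 1 ∈ Set.Ioo (0 : ℝ) 1}

/-- Dirichlet part of the boundary of the unit square: left, bottom and right sides. -/
noncomputable def squareDirichlet : Set (EuclideanSpace ℝ (Fin 2)) :=
  segment ℝ (pt 0 0) (pt 0 1) ∪ segment ℝ (pt 0 0) (pt 1 0) ∪ segment ℝ (pt 1 0) (pt 1 1)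

/-- The open right isosceles triangle with vertices `(0,0)`, `(√2,0)`, `(0,√2)`. -/
noncomputable def rightTriangle : Set (EuclideanSpace ℝ (Fin 2)) :=
  interior (convexHull ℝ ({pt 0 0, pt (Real.sqrt 2) 0, pt 0 (Real.sqrt 2)} :
    Set (EuclideanSpace ℝ (Fin 2))))

/-- Dirichlet part of the boundary of the triangle: the hypotenuse and the vertical leg. -/
noncomputable def triangleDirichlet : Set (EuclideanSpace ℝ (Fin 2)) :=
  segment ℝ (pt (Real.sqrt 2) 0) (pt 0 (Real.sqrt 2)) ∪ segment ℝ (pt 0 0) (pt 0 (Real.sqrt 2))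

section Mollification

open Set Filter Topology Metric Function
open scoped Convolution NNReal Gradient

abbrev Plane := EuclideanSpace ℝ (Fin 2)

/-- Convolution of `g` with the normalized bump function `φ`. -/
noncomputable def mollify (φ : ContDiffBump (0 : Plane)) (g : Plane → ℝ) : Plane → ℝ :=
  φ.normed volume ⋆[ContinuousLinearMap.lsmul ℝ ℝ, volume] g

lemma contDiff_mollify (φ : ContDiffBump (0 : Plane)) {g : Plane → ℝ} (hg : Continuous g) :
    ContDiff ℝ (⊤ : ℕ∞) (mollify φ g) :=
  φ.hasCompactSupport_normed.contDiff_convolution_left _ φ.contDiff_normed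
    hg.locallyIntegrable

lemma abs_mollify_sub_le (φ : ContDiffBump (0 : Plane)) {g : Plane → ℝ} (hg : Continuous g)
    {x : Plane} {ε : ℝ} (h : ∀ y ∈ ball x φ.rOut, |g y - g x| ≤ ε) :
    |mollify φ g x - g x| ≤ ε :=
  φ.dist_normed_convolution_le hg.aestronglyMeasurable h

lemma abs_mollify_sub_sub_le (φ : ContDiffBump (0 : Plane)) {g : Plane → ℝ} (hg : Continuous g)
    {x x' : Plane} {z ε : ℝ} (hε : 0 ≤ ε)
    (h : ∀ y ∈ ball (0 : Plane) φ.rOut, |g (x + y) - g (x' + y) - z| ≤ ε) :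
    |mollify φ g x - mollify φ g x' - z| ≤ ε := by
  have hex : ∀ p, ConvolutionExistsAt (φ.normed volume) g p
      (ContinuousLinearMap.lsmul ℝ ℝ) volume := fun p =>
    (φ.hasCompactSupport_normed.convolutionExists_left _ φ.continuous_normed
      hg.locallyIntegrable) p
  have key : mollify φ g x - mollify φ g x' =
      (φ.normed volume ⋆[ContinuousLinearMap.lsmul ℝ ℝ, volume]
        fun y => g (x + y) - g (x' + y)) 0 := by
    simp only [mollify, convolution_def]
    rw [← integral_sub (hex x) (hex x')]
    congr 1 with t
    simp [sub_eq_add_neg]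
    ring
  rw [key]
  exact dist_convolution_le hε φ.support_normed_eq.subset φ.nonneg_normed φ.integral_normed
    (by fun_prop : Continuous fun y => g (x + y) - g (x' + y)).aestronglyMeasurable h

lemma norm_fderiv_sub_le_of_eventually {w : Plane → ℝ} {x : Plane} (hw : DifferentiableAt ℝ w x)
    {D : Plane →L[ℝ] ℝ} {K : ℝ} (hK : 0 ≤ K)
    (h : ∀ᶠ y in 𝓝 x, |w y - w x - D (y - x)| ≤ K * ‖y - x‖) : ‖fderiv ℝ w x - D‖ ≤ K := by
  refine (hw.hasFDerivAt.sub D.hasFDerivAt).le_of_lip' hK ?_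
  filter_upwards [h] with y hy
  have : (w - ⇑D) y - (w - ⇑D) x = w y - w x - D (y - x) := by
    simp only [Pi.sub_apply, map_sub]; ring
  rwa [this]

/-- A Lipschitz function vanishing off a convex open set `U` is approximated, together with its
gradient, by smooth functions vanishing near a compact set disjoint from `U`. -/
lemma exists_smooth_approximation {U Γ : Set Plane} (hUo : IsOpen U) (hUc : Convex ℝ U)
    (hUn : U.Nonempty) (hΓ : IsCompact Γ) (hd : Disjoint Γ U) {v : Plane → ℝ} {L : ℝ≥0}
    (hv : LipschitzWith L v) (hv0 : ∀ x ∉ U, v x = 0) :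
    ∃ w : ℕ → Plane → ℝ,
      (∀ n, ContDiff ℝ (⊤ : ℕ∞) (w n) ∧ ∃ V : Set Plane, IsOpen V ∧ Γ ⊆ V ∧ EqOn (w n) 0 V) ∧
      (∀ x, Tendsto (fun n => w n x) atTop (𝓝 (v x))) ∧
      (∀ n x, ‖fderiv ℝ (w n) x‖ ≤ 2 * L) ∧
      (∃ c : Plane, ∀ n x, |w n x - v x| ≤ 2 * L * (‖x - c‖ + 1)) ∧
      (∀ x D, HasStrictFDerivAt v D x →
        Tendsto (fun n => fderiv ℝ (w n) x) atTop (𝓝 D)) := by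
  obtain ⟨c, hc⟩ := hUn
  set τ : ℕ → ℝ := fun n => 1 / ((n : ℝ) + 1) with hτ
  have hτ0 : ∀ n, 0 < τ n := fun n => by positivity
  have hτ1 : ∀ n, τ n ≤ 1 := fun n => by
    rw [hτ]; simp only; rw [div_le_one (by positivity)]; linarith [(Nat.cast_nonneg n : (0:ℝ) ≤ n)]
  have hτlim : Tendsto τ atTop (𝓝 0) := tendsto_one_div_add_atTop_nhds_zero_nat
  set h : ℕ → Plane → Plane := fun n x => x + τ n • (x - c) with hh
  have hcont : ∀ n, Continuous (h n) := fun n => by fun_prop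
  have hsub : ∀ n x y, h n x - h n y = (1 + τ n) • (x - y) := fun n x y => by
    simp only [hh]; module
  have hsep : ∀ n, ∃ δ : ℝ, 0 < δ ∧ δ ≤ τ n ∧
      ∀ x ∈ thickening δ Γ, ∀ y ∈ ball x δ, h n y ∉ U := by
    intro n
    have hdis : Disjoint Γ (h n ⁻¹' closure U) := by
      rw [Set.disjoint_left]
      intro x hx hx'
      have hx2 := hUc.closure_subset_image_homothety_interior_of_one_lt
        (x := c) (by rwa [hUo.interior_eq]) (1 + τ n) (by linarith [hτ0 n]) hx'
      rw [hUo.interior_eq] at hx2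
      obtain ⟨z, hz, hzx⟩ := hx2
      have hz' : (1 + τ n) • (z - x) = 0 := by
        have : (1 + τ n) • (z - c) + c = x + τ n • (x - c) := hzx
        have h2 : (1 + τ n) • (z - x) = ((1 + τ n) • (z - c) + c) - (x + τ n • (x - c)) := by
          module
        rw [h2, this, sub_self]
      rw [smul_eq_zero, sub_eq_zero] at hz'
      rcases hz' with hz' | rfl
      · linarith [hτ0 n]
      · exact Set.disjoint_left.1 hd hx hz
    obtain ⟨δ, hδ, hδd⟩ := hdis.exists_thickenings hΓ (isClosed_closure.preimage (hcont n))
    refine ⟨min (δ / 2) (τ n), lt_min (by positivity) (hτ0 n), min_le_right _ _, ?_⟩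
    intro x hx y hy hyU
    have hyδ : y ∈ thickening δ (h n ⁻¹' closure U) :=
      self_subset_thickening hδ _ (subset_closure hyU)
    refine Set.disjoint_left.1 hδd ?_ hyδ
    rw [mem_thickening_iff] at hx ⊢
    obtain ⟨z, hz, hxz⟩ := hx
    refine ⟨z, hz, ?_⟩
    have h1 := dist_triangle y x z
    have h2 := mem_ball.1 hy
    have h3 := min_le_left (δ / 2) (τ n)
    linarith
  choose δ hδ0 hδτ hδ using hsep
  set φ : ℕ → ContDiffBump (0 : Plane) := fun n => ⟨δ n / 2, δ n, by linarith [hδ0 n],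
    by linarith [hδ0 n]⟩ with hφ
  have hφr : ∀ n, (φ n).rOut = δ n := fun n => rfl
  set g : ℕ → Plane → ℝ := fun n x => v (h n x) with hg
  have hgc : ∀ n, Continuous (g n) := fun n => hv.continuous.comp (hcont n)
  have hvL : ∀ x y, |v x - v y| ≤ L * ‖x - y‖ := fun x y => by
    simpa [Real.dist_eq, dist_eq_norm] using hv.dist_le_mul x y
  have hgL : ∀ n x y, |g n x - g n y| ≤ 2 * L * ‖x - y‖ := fun n x y => by
    refine (hvL _ _).trans ?_
    rw [hsub, norm_smul, Real.norm_of_nonneg (by linarith [hτ0 n])]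
    have : (1 + τ n) * ‖x - y‖ ≤ 2 * ‖x - y‖ := by gcongr; linarith [hτ1 n]
    nlinarith [L.2, this]
  have hclose : ∀ n x, |mollify (φ n) (g n) x - v x| ≤ 2 * L * τ n * (‖x - c‖ + 1) := by
    intro n x
    have h1 : |mollify (φ n) (g n) x - g n x| ≤ 2 * L * τ n := by
      refine abs_mollify_sub_le _ (hgc n) fun y hy => (hgL n y x).trans ?_
      rw [mem_ball, dist_eq_norm, hφr] at hy
      gcongr
      exact hy.le.trans (hδτ n)
    have h2 : |g n x - v x| ≤ L * (τ n * ‖x - c‖) := by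
      refine (hvL _ _).trans (le_of_eq ?_)
      simp [hh, norm_smul, abs_of_pos (hτ0 n)]
    have h3 := abs_sub_le (mollify (φ n) (g n) x) (g n x) (v x)
    have h4 : 0 ≤ L * (τ n * ‖x - c‖) := by have := hτ0 n; positivity
    nlinarith
  refine ⟨fun n => mollify (φ n) (g n), fun n => ⟨contDiff_mollify _ (hgc n), thickening (δ n) Γ,
    isOpen_thickening, self_subset_thickening (hδ0 n) _, ?_⟩, ?_, ?_, ⟨c, ?_⟩, ?_⟩
  · intro x hx
    have hx0 : ∀ y ∈ ball x (φ n).rOut, g n y = 0 := fun y hy => hv0 _ (hδ n x hx y hy)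
    have hxx := hx0 x (mem_ball_self (φ n).rOut_pos)
    have := abs_mollify_sub_le (φ n) (hgc n) (x := x) (ε := 0)
      (fun y hy => by rw [hx0 y hy, hxx]; simp)
    rw [hxx, sub_zero] at this
    simpa using this
  · intro x
    rw [tendsto_iff_dist_tendsto_zero]
    refine squeeze_zero (fun n => dist_nonneg) (fun n => hclose n x) ?_
    have := (hτlim.const_mul (2 * (L : ℝ))).mul_const (‖x - c‖ + 1)
    simpa using this
  · intro n x
    have := norm_fderiv_sub_le_of_eventually (w := mollify (φ n) (g n)) (x := x) (D := 0)
      (K := 2 * L) ((contDiff_mollify _ (hgc n)).differentiable (by simp) x)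
      (by positivity) (Eventually.of_forall fun y => ?_)
    · simpa using this
    · refine abs_mollify_sub_sub_le _ (hgc n) (by positivity) fun z _ => ?_
      simpa using hgL n (y + z) (x + z)
  · intro n x
    refine (hclose n x).trans ?_
    have : 2 * L * τ n ≤ 2 * L := mul_le_of_le_one_right (by positivity) (hτ1 n)
    gcongr
  · intro x D hD
    have hlim : Tendsto (fun n => (1 + τ n) • D) atTop (𝓝 D) := by
      simpa using (hτlim.const_add 1).smul_const D
    rw [tendsto_iff_dist_tendsto_zero]
    have hsq : Tendsto (fun n => dist (fderiv ℝ (mollify (φ n) (g n)) x) ((1 + τ n) • D)) atTop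
        (𝓝 0) := by
      rw [Metric.tendsto_atTop]
      intro ε hε
      have hε4 : 0 < ε / 4 := by positivity
      have hst := hD.isLittleO.def hε4
      rw [nhds_prod_eq] at hst
      obtain ⟨ρ, hρ, hball⟩ := Metric.eventually_nhds_iff_ball.1
        (by rw [← nhds_prod_eq] at hst; exact hst)
      have hev : ∀ᶠ n in atTop, τ n * (‖x - c‖ + 4) < ρ := by
        have := hτlim.mul_const (‖x - c‖ + 4)
        rw [zero_mul] at this
        exact this.eventually_lt_const hρ
      obtain ⟨N, hN⟩ := eventually_atTop.1 hev
      refine ⟨N, fun n hn => ?_⟩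
      have hn' := hN n hn
      rw [dist_zero_right, Real.norm_of_nonneg dist_nonneg, dist_eq_norm]
      refine lt_of_le_of_lt (norm_fderiv_sub_le_of_eventually (K := ε / 2)
        ((contDiff_mollify _ (hgc n)).differentiable (by simp) x) (by positivity) ?_)
        (by linarith)
      filter_upwards [ball_mem_nhds x (hτ0 n)] with y hy
      refine abs_mollify_sub_sub_le _ (hgc n) (by positivity) fun z hz => ?_
      rw [mem_ball, dist_zero_right, hφr] at hz
      rw [mem_ball, dist_eq_norm] at hy
      have hnear : ∀ p : Plane, ‖p‖ < 2 * τ n → h n (x + p) ∈ ball x ρ := by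
        intro p hp
        rw [mem_ball, dist_eq_norm]
        have e : h n (x + p) - x = (1 + τ n) • p + τ n • (x - c) := by
          simp only [hh]; module
        rw [e]
        refine (norm_add_le _ _).trans_lt ?_
        rw [norm_smul, norm_smul, Real.norm_of_nonneg (hτ0 n).le,
          Real.norm_of_nonneg (by linarith [hτ0 n])]
        have := hτ1 n
        have := hτ0 n
        nlinarith [norm_nonneg p]
      have hp1 : h n (y + z) ∈ ball x ρ := by
        have := hnear ((y - x) + z) (by
          have := norm_add_le (y - x) z
          have := hδτ n
          linarith)
        rwa [← add_assoc, add_sub_cancel] at this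
      have hp2 : h n (x + z) ∈ ball x ρ := hnear z (by linarith [hδτ n, hτ0 n])
      have hb := hball (h n (y + z), h n (x + z)) (by
        rw [← ball_prod_same]; exact ⟨hp1, hp2⟩)
      simp only [hsub] at hb
      have e2 : y + z - (x + z) = y - x := by abel
      rw [e2] at hb
      rw [map_smul, norm_smul (1 + τ n), Real.norm_of_nonneg (by linarith [hτ0 n] : 0 ≤ 1 + τ n),
        Real.norm_eq_abs] at hb
      refine hb.trans ?_
      have h2 : (1 + τ n) * ‖y - x‖ ≤ 2 * ‖y - x‖ := by gcongr; linarith [hτ1 n]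
      nlinarith
    refine squeeze_zero (fun n => dist_nonneg) (fun n => dist_triangle _ ((1 + τ n) • D) _) ?_
    have := hsq.add (tendsto_iff_dist_tendsto_zero.1 hlim)
    simpa using this

end Mollification

section QuadraticForms

open Filter Topology

variable {ι : Type*} [Fintype ι]

/-- Positive definiteness of a quadratic form is stable under entrywise convergence. -/
lemma eventually_quadratic_pos {q : ι → ι → ℝ} {qn : ℕ → ι → ι → ℝ}
    (hq : ∀ x : ι → ℝ, x ≠ 0 → 0 < ∑ i, ∑ j, x i * x j * q i j)
    (h : ∀ i j, Tendsto (fun n => qn n i j) atTop (𝓝 (q i j))) :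
    ∀ᶠ n in atTop, ∀ x : ι → ℝ, x ≠ 0 → 0 < ∑ i, ∑ j, x i * x j * qn n i j := by
  have hqn : Tendsto qn atTop (𝓝 q) :=
    tendsto_pi_nhds.2 fun i => tendsto_pi_nhds.2 fun j => h i j
  have hcont : Continuous fun p : (ι → ι → ℝ) × (ι → ℝ) =>
      ∑ i, ∑ j, p.2 i * p.2 j * p.1 i j := by fun_prop
  have hsph : ∀ᶠ q' in 𝓝 q, ∀ x ∈ Metric.sphere (0 : ι → ℝ) 1,
      0 < ∑ i, ∑ j, x i * x j * q' i j := by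
    refine (isCompact_sphere _ _).eventually_forall_of_forall_eventually fun x hx => ?_
    have hx0 : x ≠ 0 := by
      rintro rfl
      simp at hx
    exact hcont.continuousAt.eventually_const_lt (hq x hx0)
  filter_upwards [hqn.eventually hsph] with n hn x hx
  have hpos : 0 < ‖x‖ := norm_pos_iff.2 hx
  have h1 := hn (‖x‖⁻¹ • x) (by simp [norm_smul, hpos.ne'])
  have h2 : ∑ i, ∑ j, (‖x‖⁻¹ • x) i * (‖x‖⁻¹ • x) j * qn n i j =
      (‖x‖⁻¹) ^ 2 * ∑ i, ∑ j, x i * x j * qn n i j := by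
    simp only [Finset.mul_sum, Pi.smul_apply, smul_eq_mul]
    refine Finset.sum_congr rfl fun i _ => Finset.sum_congr rfl fun j _ => by ring
  rw [h2] at h1
  exact pos_of_mul_pos_right h1 (by positivity)

lemma exists_quadratic_le {a b : ι → ι → ℝ}
    (hb : ∀ x : ι → ℝ, x ≠ 0 → 0 < ∑ i, ∑ j, x i * x j * b i j) :
    ∃ C : ℝ, ∀ x : ι → ℝ, ∑ i, ∑ j, x i * x j * a i j ≤ C * ∑ i, ∑ j, x i * x j * b i j := by
  have hlim : ∀ i j, Tendsto (fun n : ℕ => b i j - (1 / ((n : ℝ) + 1)) * a i j) atTop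
      (𝓝 (b i j)) := fun i j => by
    simpa using (tendsto_one_div_add_atTop_nhds_zero_nat.mul_const (a i j)).const_sub (b i j)
  obtain ⟨n, hn⟩ := (eventually_quadratic_pos hb hlim).exists
  refine ⟨n + 1, fun x => ?_⟩
  rcases eq_or_ne x 0 with rfl | hx
  · simp
  · have h1 := hn x hx
    have h2 : ∑ i, ∑ j, x i * x j * (b i j - (1 / ((n : ℝ) + 1)) * a i j) =
        ∑ i, ∑ j, x i * x j * b i j - (1 / ((n : ℝ) + 1)) * ∑ i, ∑ j, x i * x j * a i j := by
      simp only [Finset.mul_sum, ← Finset.sum_sub_distrib]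
      refine Finset.sum_congr rfl fun i _ => Finset.sum_congr rfl fun j _ => by ring
    rw [h2] at h1
    have hn0 : (0 : ℝ) < n + 1 := by positivity
    have h3 : (1 / ((n : ℝ) + 1)) * ∑ i, ∑ j, x i * x j * a i j ≤ ∑ i, ∑ j, x i * x j * b i j := by
      linarith
    rwa [one_div_mul_eq_div, div_le_iff₀ hn0, mul_comm] at h3

end QuadraticForms

section InnerIntegrals

open Filter Topology Set
open scoped Gradient RealInnerProductSpace

variable {F : Type*} [NormedAddCommGroup F] [InnerProductSpace ℝ F] {Ω : Set Plane}

lemma Continuous.integrableOn_of_isBounded {f : Plane → ℝ} (hf : Continuous f)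
    (hΩ : Bornology.IsBounded Ω) : IntegrableOn f Ω :=
  (hf.continuousOn.integrableOn_compact (hΩ.isCompact_closure)).mono_set subset_closure

lemma setIntegral_norm_sum_sq (hΩ : Bornology.IsBounded Ω) {ι : Type*} [Fintype ι]
    {f : ι → Plane → F} (hf : ∀ i, Continuous (f i)) (x : ι → ℝ) :
    ∫ p in Ω, ‖∑ i, x i • f i p‖ ^ 2 = ∑ i, ∑ j, x i * x j * ∫ p in Ω, ⟪f i p, f j p⟫ := by
  have hint : ∀ i j, IntegrableOn (fun p => x i * x j * ⟪f i p, f j p⟫) Ω := fun i j =>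
    (continuous_const.mul ((hf i).inner (hf j))).integrableOn_of_isBounded hΩ
  trans ∫ p in Ω, ∑ i, ∑ j, x i * x j * ⟪f i p, f j p⟫
  · congr 1 with p
    rw [← real_inner_self_eq_norm_sq, sum_inner]
    refine Finset.sum_congr rfl fun i _ => ?_
    rw [inner_sum]
    refine Finset.sum_congr rfl fun j _ => ?_
    rw [real_inner_smul_left, real_inner_smul_right]
    ring
  · rw [integral_finsetSum _ fun i _ => integrable_finsetSum _ fun j _ => hint i j]
    refine Finset.sum_congr rfl fun i _ => ?_
    rw [integral_finsetSum _ fun j _ => hint i j]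
    simp only [integral_const_mul]

lemma tendsto_setIntegral_inner (hΩ : Bornology.IsBounded Ω) (hΩm : MeasurableSet Ω)
    {f g : ℕ → Plane → F}
    {f' g' : Plane → F} (hf : ∀ n, Continuous (f n)) (hg : ∀ n, Continuous (g n)) {C C' : ℝ}
    (hfC : ∀ n, ∀ p ∈ Ω, ‖f n p‖ ≤ C) (hgC : ∀ n, ∀ p ∈ Ω, ‖g n p‖ ≤ C')
    (hf' : ∀ᵐ p ∂volume.restrict Ω, Tendsto (fun n => f n p) atTop (𝓝 (f' p)))
    (hg' : ∀ᵐ p ∂volume.restrict Ω, Tendsto (fun n => g n p) atTop (𝓝 (g' p))) :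
    Tendsto (fun n => ∫ p in Ω, ⟪f n p, g n p⟫) atTop (𝓝 (∫ p in Ω, ⟪f' p, g' p⟫)) := by
  refine tendsto_integral_of_dominated_convergence (fun _ => C * C')
    (fun n => ((hf n).inner (hg n)).aestronglyMeasurable)
    (continuous_const.integrableOn_of_isBounded hΩ) (fun n => ?_) ?_
  · refine (ae_restrict_iff' hΩm).2 (ae_of_all _ fun p hp => ?_)
    exact (norm_inner_le_norm _ _).trans (mul_le_mul (hfC n p hp) (hgC n p hp) (norm_nonneg _)
      ((norm_nonneg _).trans (hfC n p hp)))
  · filter_upwards [hf', hg'] with p h1 h2 using h1.inner h2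

end InnerIntegrals

section Transplantation

open Filter Topology Set
open scoped Gradient RealInnerProductSpace

lemma AffineIsometryEquiv.measurePreserving_plane (φ : Plane ≃ᵃⁱ[ℝ] Plane) :
    MeasurePreserving φ volume volume := by
  have h : (φ : Plane → Plane) = (fun x => x + φ 0) ∘ φ.linearIsometryEquiv := by
    ext1 x
    have := φ.map_vadd 0 x
    simpa using this
  rw [h]
  exact (measurePreserving_add_right volume (φ 0)).comp φ.linearIsometryEquiv.measurePreserving

lemma AffineIsometryEquiv.contDiff_plane (φ : Plane ≃ᵃⁱ[ℝ] Plane) {n : WithTop ℕ∞} :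
    ContDiff ℝ n φ := by
  have h : (φ : Plane → Plane) = fun x => φ.linearIsometryEquiv x + φ 0 := by
    ext1 x
    have := φ.map_vadd 0 x
    simpa using this
  rw [h]
  exact φ.linearIsometryEquiv.contDiff.add contDiff_const

lemma gradient_comp_affineIsometryEquiv (φ : Plane ≃ᵃⁱ[ℝ] Plane) {u : Plane → ℝ} {x : Plane}
    (hu : DifferentiableAt ℝ u (φ x)) :
    ∇ (fun y => u (φ y)) x = φ.linearIsometryEquiv.symm (∇ u (φ x)) := by
  have hφ : HasFDerivAt (φ : Plane → Plane)
      (φ.linearIsometryEquiv.toContinuousLinearEquiv : Plane →L[ℝ] Plane) x := by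
    have h : (φ : Plane → Plane) = fun x => φ.linearIsometryEquiv x + φ 0 := by
      ext1 x
      have := φ.map_vadd 0 x
      simpa using this
    rw [h]
    exact (φ.linearIsometryEquiv.toContinuousLinearEquiv.hasFDerivAt).add_const _
  have h := hu.hasGradientAt.hasFDerivAt.comp x hφ
  refine HasGradientAt.gradient (hasGradientAt_iff_hasFDerivAt.2 ?_)
  convert! h using 1
  ext y
  simp [LinearIsometryEquiv.inner_map_eq_flip]

lemma inner_gradient_comp_affineIsometryEquiv (φ : Plane ≃ᵃⁱ[ℝ] Plane) {u u' : Plane → ℝ}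
    {x : Plane} (hu : DifferentiableAt ℝ u (φ x)) (hu' : DifferentiableAt ℝ u' (φ x)) :
    ⟪∇ (fun y => u (φ y)) x, ∇ (fun y => u' (φ y)) x⟫ = ⟪∇ u (φ x), ∇ u' (φ x)⟫ := by
  rw [gradient_comp_affineIsometryEquiv φ hu, gradient_comp_affineIsometryEquiv φ hu',
    LinearIsometryEquiv.inner_map_map]

lemma ContDiff.continuous_gradient {u : Plane → ℝ} (hu : ContDiff ℝ (⊤ : ℕ∞) u) :
    Continuous (∇ u) :=
  (InnerProductSpace.toDual ℝ Plane).symm.continuous.comp (hu.continuous_fderiv (by simp))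

/-- Up to a null set, `Ω` is the disjoint union of the isometric copies `φ₁ '' T` and `φ₂ '' T`
of `T`. -/
structure IsTiledBy (T Ω : Set Plane) (φ₁ φ₂ : Plane ≃ᵃⁱ[ℝ] Plane) : Prop where
  disjoint : Disjoint (φ₁ '' T) (φ₂ '' T)
  ae_eq : (φ₁ '' T ∪ φ₂ '' T : Set Plane) =ᵐ[volume] Ω

lemma IsTiledBy.symm {T Ω : Set Plane} {φ₁ φ₂ : Plane ≃ᵃⁱ[ℝ] Plane} (h : IsTiledBy T Ω φ₁ φ₂) :
    IsTiledBy T Ω φ₂ φ₁ :=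
  ⟨h.disjoint.symm, by rw [union_comm]; exact h.ae_eq⟩

lemma IsTiledBy.setIntegral {T Ω : Set Plane} {φ₁ φ₂ : Plane ≃ᵃⁱ[ℝ] Plane}
    (h : IsTiledBy T Ω φ₁ φ₂) (hT : IsOpen T) {f : Plane → ℝ}
    (h₁ : IntegrableOn (fun x => f (φ₁ x)) T) (h₂ : IntegrableOn (fun x => f (φ₂ x)) T) :
    ∫ x in Ω, f x = ∫ x in T, (f (φ₁ x) + f (φ₂ x)) := by
  have hemb : ∀ φ : Plane ≃ᵃⁱ[ℝ] Plane, MeasurableEmbedding φ := fun φ =>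
    φ.toHomeomorph.measurableEmbedding
  rw [← setIntegral_congr_set h.ae_eq, setIntegral_union h.disjoint
    ((hemb φ₂).measurableSet_image.2 hT.measurableSet)
    ((φ₁.measurePreserving_plane.integrableOn_image (hemb φ₁)).2 h₁)
    ((φ₂.measurePreserving_plane.integrableOn_image (hemb φ₂)).2 h₂),
    φ₁.measurePreserving_plane.setIntegral_image_emb (hemb φ₁),
    φ₂.measurePreserving_plane.setIntegral_image_emb (hemb φ₂), integral_add h₁ h₂]

/-- `v` is obtained from `u` by transplantation: on the two tiles it equals the sum and the
difference of the two pieces of `u`. -/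
structure IsTransplant (T : Set Plane) (φ₁ φ₂ ψ₁ ψ₂ : Plane ≃ᵃⁱ[ℝ] Plane)
    (u v : Plane → ℝ) : Prop where
  sum : ∀ x ∈ T, v (ψ₁ x) = u (φ₁ x) + u (φ₂ x)
  diff : ∀ x ∈ T, v (ψ₂ x) = u (φ₂ x) - u (φ₁ x)

variable {T Ω₁ Ω₂ : Set Plane} {φ₁ φ₂ ψ₁ ψ₂ : Plane ≃ᵃⁱ[ℝ] Plane}

lemma setIntegral_eq_two_mul_of_tiles (hT : IsOpen T) (hTb : Bornology.IsBounded T)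
    (h₁ : IsTiledBy T Ω₁ φ₁ φ₂) (h₂ : IsTiledBy T Ω₂ ψ₁ ψ₂) {f g G₁ G₂ : Plane → ℝ}
    (hf : Continuous f) (hG₁ : Continuous G₁) (hG₂ : Continuous G₂)
    (hg₁ : ∀ x ∈ T, g (ψ₁ x) = G₁ x) (hg₂ : ∀ x ∈ T, g (ψ₂ x) = G₂ x)
    (hG : ∀ x ∈ T, G₁ x + G₂ x = 2 * (f (φ₁ x) + f (φ₂ x))) :
    ∫ x in Ω₂, g x = 2 * ∫ x in Ω₁, f x := by
  rw [h₁.setIntegral hT ((hf.comp φ₁.continuous).integrableOn_of_isBounded hTb)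
    ((hf.comp φ₂.continuous).integrableOn_of_isBounded hTb),
    h₂.setIntegral hT ((hG₁.integrableOn_of_isBounded hTb).congr_fun
      (fun x hx => (hg₁ x hx).symm) hT.measurableSet)
      ((hG₂.integrableOn_of_isBounded hTb).congr_fun
      (fun x hx => (hg₂ x hx).symm) hT.measurableSet), ← integral_const_mul]
  refine setIntegral_congr_fun hT.measurableSet fun x hx => ?_
  rw [hg₁ x hx, hg₂ x hx, hG x hx]

lemma IsTransplant.setIntegral_mul (hT : IsOpen T) (hTb : Bornology.IsBounded T)
    (h₁ : IsTiledBy T Ω₁ φ₁ φ₂) (h₂ : IsTiledBy T Ω₂ ψ₁ ψ₂) {u u' v v' : Plane → ℝ}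
    (h : IsTransplant T φ₁ φ₂ ψ₁ ψ₂ u v) (h' : IsTransplant T φ₁ φ₂ ψ₁ ψ₂ u' v')
    (hu : Continuous u) (hu' : Continuous u') :
    ∫ x in Ω₂, ⟪v x, v' x⟫ = 2 * ∫ x in Ω₁, ⟪u x, u' x⟫ := by
  have c₁ := φ₁.continuous
  have c₂ := φ₂.continuous
  refine setIntegral_eq_two_mul_of_tiles hT hTb h₁ h₂ (by fun_prop)
    (G₁ := fun x => ⟪u (φ₁ x) + u (φ₂ x), u' (φ₁ x) + u' (φ₂ x)⟫)
    (G₂ := fun x => ⟪u (φ₂ x) - u (φ₁ x), u' (φ₂ x) - u' (φ₁ x)⟫)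
    (by fun_prop) (by fun_prop) (fun x hx => by rw [h.sum x hx, h'.sum x hx])
    (fun x hx => by rw [h.diff x hx, h'.diff x hx]) fun x _ => ?_
  simp only [inner_add_left, inner_add_right, inner_sub_left, inner_sub_right]
  ring

lemma contDiffAt_of_comp_affineIsometryEquiv (hT : IsOpen T) (ψ : Plane ≃ᵃⁱ[ℝ] Plane)
    {v s : Plane → ℝ} (hs : ContDiff ℝ (⊤ : ℕ∞) s) (h : ∀ x ∈ T, v (ψ x) = s x) {x : Plane}
    (hx : x ∈ T) : ContDiffAt ℝ (⊤ : ℕ∞) v (ψ x) := by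
  refine (hs.comp ψ.symm.contDiff_plane).contDiffAt.congr_of_eventuallyEq ?_
  have hmem : ∀ᶠ y in 𝓝 (ψ x), ψ.symm y ∈ T :=
    ψ.symm.continuous.continuousAt.eventually_mem (by simpa using hT.mem_nhds hx)
  filter_upwards [hmem] with y hy
  simpa using h _ hy

lemma IsTransplant.contDiffAt (hT : IsOpen T) {u v : Plane → ℝ}
    (h : IsTransplant T φ₁ φ₂ ψ₁ ψ₂ u v) (hu : ContDiff ℝ (⊤ : ℕ∞) u) {x : Plane} (hx : x ∈ T) :
    ContDiffAt ℝ (⊤ : ℕ∞) v (ψ₁ x) ∧ ContDiffAt ℝ (⊤ : ℕ∞) v (ψ₂ x) :=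
  ⟨contDiffAt_of_comp_affineIsometryEquiv hT ψ₁
    ((hu.comp φ₁.contDiff_plane).add (hu.comp φ₂.contDiff_plane)) h.sum hx,
   contDiffAt_of_comp_affineIsometryEquiv hT ψ₂
    ((hu.comp φ₂.contDiff_plane).sub (hu.comp φ₁.contDiff_plane)) h.diff hx⟩

lemma IsTransplant.ae_hasStrictFDerivAt (hT : IsOpen T) (hΩ : MeasurableSet Ω₂)
    (h₂ : IsTiledBy T Ω₂ ψ₁ ψ₂) {u v : Plane → ℝ} (h : IsTransplant T φ₁ φ₂ ψ₁ ψ₂ u v)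
    (hu : ContDiff ℝ (⊤ : ℕ∞) u) :
    ∀ᵐ x ∂volume.restrict Ω₂, HasStrictFDerivAt v (fderiv ℝ v x) x := by
  rw [ae_restrict_iff' hΩ]
  filter_upwards [h₂.ae_eq.mem_iff] with x hx hxΩ
  have hcd : ContDiffAt ℝ (⊤ : ℕ∞) v x := by
    rcases hx.2 hxΩ with ⟨y, hy, rfl⟩ | ⟨y, hy, rfl⟩
    exacts [(h.contDiffAt hT hu hy).1, (h.contDiffAt hT hu hy).2]
  exact hcd.hasStrictFDerivAt (by simp)

lemma inner_gradient_of_comp_eq (hT : IsOpen T) (ψ : Plane ≃ᵃⁱ[ℝ] Plane)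
    {v v' s s' : Plane → ℝ} (hs : ContDiff ℝ (⊤ : ℕ∞) s) (hs' : ContDiff ℝ (⊤ : ℕ∞) s')
    (h : ∀ x ∈ T, v (ψ x) = s x) (h' : ∀ x ∈ T, v' (ψ x) = s' x) {x : Plane} (hx : x ∈ T) :
    ⟪∇ v (ψ x), ∇ v' (ψ x)⟫ = ⟪∇ s x, ∇ s' x⟫ := by
  rw [← inner_gradient_comp_affineIsometryEquiv ψ
    ((contDiffAt_of_comp_affineIsometryEquiv hT ψ hs h hx).differentiableAt (by simp))
    ((contDiffAt_of_comp_affineIsometryEquiv hT ψ hs' h' hx).differentiableAt (by simp))]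
  have e : (fun y => v (ψ y)) =ᶠ[𝓝 x] s := eventually_of_mem (hT.mem_nhds hx) h
  have e' : (fun y => v' (ψ y)) =ᶠ[𝓝 x] s' := eventually_of_mem (hT.mem_nhds hx) h'
  rw [e.gradient_eq, e'.gradient_eq]

lemma gradient_add_of_differentiable {a b : Plane → ℝ} {x : Plane}
    (ha : DifferentiableAt ℝ a x) (hb : DifferentiableAt ℝ b x) :
    ∇ (fun y => a y + b y) x = ∇ a x + ∇ b x := by
  simp [gradient, fderiv_fun_add ha hb]

lemma gradient_sub_of_differentiable {a b : Plane → ℝ} {x : Plane}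
    (ha : DifferentiableAt ℝ a x) (hb : DifferentiableAt ℝ b x) :
    ∇ (fun y => a y - b y) x = ∇ a x - ∇ b x := by
  simp [gradient, fderiv_fun_sub ha hb]

lemma IsTransplant.setIntegral_inner_gradient (hT : IsOpen T) (hTb : Bornology.IsBounded T)
    (h₁ : IsTiledBy T Ω₁ φ₁ φ₂) (h₂ : IsTiledBy T Ω₂ ψ₁ ψ₂) {u u' v v' : Plane → ℝ}
    (h : IsTransplant T φ₁ φ₂ ψ₁ ψ₂ u v) (h' : IsTransplant T φ₁ φ₂ ψ₁ ψ₂ u' v')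
    (hu : ContDiff ℝ (⊤ : ℕ∞) u) (hu' : ContDiff ℝ (⊤ : ℕ∞) u') :
    ∫ x in Ω₂, ⟪∇ v x, ∇ v' x⟫ = 2 * ∫ x in Ω₁, ⟪∇ u x, ∇ u' x⟫ := by
  have hc : ∀ (φ : Plane ≃ᵃⁱ[ℝ] Plane) {w : Plane → ℝ}, ContDiff ℝ (⊤ : ℕ∞) w →
      ContDiff ℝ (⊤ : ℕ∞) fun x => w (φ x) := fun φ w hw => hw.comp φ.contDiff_plane
  have hd : ∀ {w : Plane → ℝ}, ContDiff ℝ (⊤ : ℕ∞) w → ∀ x, DifferentiableAt ℝ w x :=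
    fun hw => hw.differentiable (by simp)
  have s₁ := (hc φ₁ hu).add (hc φ₂ hu)
  have s₁' := (hc φ₁ hu').add (hc φ₂ hu')
  have s₂ := (hc φ₂ hu).sub (hc φ₁ hu)
  have s₂' := (hc φ₂ hu').sub (hc φ₁ hu')
  refine setIntegral_eq_two_mul_of_tiles hT hTb h₁ h₂
    (hu.continuous_gradient.inner hu'.continuous_gradient)
    (s₁.continuous_gradient.inner s₁'.continuous_gradient)
    (s₂.continuous_gradient.inner s₂'.continuous_gradient)
    (fun x hx => inner_gradient_of_comp_eq hT ψ₁ s₁ s₁' h.sum h'.sum hx)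
    (fun x hx => inner_gradient_of_comp_eq hT ψ₂ s₂ s₂' h.diff h'.diff hx) fun x _ => ?_
  rw [gradient_add_of_differentiable (hd (hc φ₁ hu) x) (hd (hc φ₂ hu) x),
    gradient_add_of_differentiable (hd (hc φ₁ hu') x) (hd (hc φ₂ hu') x),
    gradient_sub_of_differentiable (hd (hc φ₂ hu) x) (hd (hc φ₁ hu) x),
    gradient_sub_of_differentiable (hd (hc φ₂ hu') x) (hd (hc φ₁ hu') x),
    ← inner_gradient_comp_affineIsometryEquiv φ₁ (hd hu _) (hd hu' _),
    ← inner_gradient_comp_affineIsometryEquiv φ₂ (hd hu _) (hd hu' _)]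
  simp only [inner_add_left, inner_add_right, inner_sub_left, inner_sub_right]
  ring

end Transplantation

section Comparison

open Filter Topology Set
open scoped Gradient RealInnerProductSpace NNReal

/-- The suprema of Rayleigh quotients over `k`-dimensional admissible spaces, whose infimum is
the mixed eigenvalue. -/
def rayleighSups (Ω ΓD : Set Plane) (k : ℕ) : Set ℝ :=
  { r : ℝ | ∃ E : Submodule ℝ (Plane → ℝ),
    Module.finrank ℝ E = k ∧
    (∀ u ∈ E, ContDiff ℝ (⊤ : ℕ∞) u ∧ ∃ V : Set Plane, IsOpen V ∧ ΓD ⊆ V ∧ Set.EqOn u 0 V) ∧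
    (∀ u ∈ E, Set.EqOn u 0 Ω → u = 0) ∧
    r = sSup { q : ℝ | ∃ u ∈ E, u ≠ (0 : Plane → ℝ) ∧
        q = (∫ x in Ω, ‖gradient u x‖ ^ 2) / (∫ x in Ω, (u x) ^ 2) } }

lemma nonneg_of_mem_rayleighSups {Ω ΓD : Set Plane} {k : ℕ} {r : ℝ}
    (hr : r ∈ rayleighSups Ω ΓD k) : 0 ≤ r := by
  obtain ⟨E, -, -, -, rfl⟩ := hr
  refine Real.sSup_nonneg ?_
  rintro q ⟨u, -, -, rfl⟩
  exact div_nonneg (integral_nonneg fun _ => by positivity)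
    (integral_nonneg fun _ => by positivity)

lemma csInf_le_csInf_of_forall_exists_le_add {S S' : Set ℝ} (hS : S.Nonempty)
    (hS' : BddBelow S') (h : ∀ r ∈ S, ∀ η > 0, ∃ r' ∈ S', r' ≤ r + η) : sInf S' ≤ sInf S := by
  refine le_csInf hS fun r hr => le_of_forall_pos_le_add fun η hη => ?_
  obtain ⟨r', hr', hle⟩ := h r hr η hη
  exact (csInf_le hS' hr').trans hle

lemma mixedEig_eq_of_forall_exists_le_add {Ω Γ Ω' Γ' : Set Plane} {k : ℕ}
    (h : ∀ r ∈ rayleighSups Ω Γ k, ∀ η > 0, ∃ r' ∈ rayleighSups Ω' Γ' k, r' ≤ r + η)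
    (h' : ∀ r ∈ rayleighSups Ω' Γ' k, ∀ η > 0, ∃ r' ∈ rayleighSups Ω Γ k, r' ≤ r + η) :
    mixedEig Ω Γ k = mixedEig Ω' Γ' k := by
  change sInf (rayleighSups Ω Γ k) = sInf (rayleighSups Ω' Γ' k)
  rcases (rayleighSups Ω Γ k).eq_empty_or_nonempty with he | hne
  · rcases (rayleighSups Ω' Γ' k).eq_empty_or_nonempty with he' | ⟨r, hr⟩
    · rw [he, he']
    · obtain ⟨r', hr', -⟩ := h' r hr 1 one_pos
      exact absurd hr' (by simp [he])
  · obtain ⟨r, hr⟩ := hne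
    obtain ⟨r', hr', -⟩ := h r hr 1 one_pos
    exact le_antisymm
      (csInf_le_csInf_of_forall_exists_le_add ⟨r', hr'⟩
        ⟨0, fun _ => nonneg_of_mem_rayleighSups⟩ h')
      (csInf_le_csInf_of_forall_exists_le_add ⟨r, hr⟩
        ⟨0, fun _ => nonneg_of_mem_rayleighSups⟩ h)

variable {Ω : Set Plane}

lemma setIntegral_sq_pos (hΩ : IsOpen Ω) (hb : Bornology.IsBounded Ω) {f : Plane → ℝ}
    (hf : Continuous f) (h : ¬ EqOn f 0 Ω) : 0 < ∫ x in Ω, f x ^ 2 := by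
  have hc : Continuous fun x => f x ^ 2 := by fun_prop
  rw [setIntegral_pos_iff_support_of_nonneg_ae (ae_of_all _ fun x => by positivity)
    (hc.integrableOn_of_isBounded hb)]
  simp only [EqOn, not_forall] at h
  obtain ⟨p, hp, hfp⟩ := h
  exact (hc.isOpen_support.inter hΩ).measure_pos _ ⟨p, by simpa using hfp, hp⟩

lemma setIntegral_sum_smul_sq (hb : Bornology.IsBounded Ω) {ι : Type*} [Fintype ι]
    {f : ι → Plane → ℝ} (hf : ∀ i, ContDiff ℝ (⊤ : ℕ∞) (f i)) (x : ι → ℝ) :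
    ∫ p in Ω, (∑ i, x i • f i) p ^ 2 = ∑ i, ∑ j, x i * x j * ∫ p in Ω, ⟪f i p, f j p⟫ := by
  rw [← setIntegral_norm_sum_sq hb fun i => (hf i).continuous]
  simp

lemma setIntegral_norm_gradient_sum_smul_sq (hb : Bornology.IsBounded Ω) {ι : Type*} [Fintype ι]
    {f : ι → Plane → ℝ} (hf : ∀ i, ContDiff ℝ (⊤ : ℕ∞) (f i)) (x : ι → ℝ) :
    ∫ p in Ω, ‖∇ (∑ i, x i • f i) p‖ ^ 2 =
      ∑ i, ∑ j, x i * x j * ∫ p in Ω, ⟪∇ (f i) p, ∇ (f j) p⟫ := by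
  rw [← setIntegral_norm_sum_sq hb fun i => (hf i).continuous_gradient]
  congr 1 with p
  have hd : ∀ i, DifferentiableAt ℝ (f i) p := fun i => (hf i).differentiable (by simp) p
  have hfd : fderiv ℝ (∑ i, x i • f i) p = ∑ i, x i • fderiv ℝ (f i) p := by
    rw [fderiv_sum fun i _ => (hd i).const_smul (x i)]
    exact Finset.sum_congr rfl fun i _ => fderiv_const_smul (hd i) (x i)
  simp [gradient, hfd]

/-- Transplantation followed by smoothing: any Rayleigh supremum for `(Ω₁, Γ₁)` is attained up
to an arbitrarily small error for `(Ω₂, Γ₂)`. -/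
theorem exists_mem_rayleighSups_le_add {T Ω₁ Ω₂ Γ₁ Γ₂ U : Set Plane}
    {φ₁ φ₂ ψ₁ ψ₂ : Plane ≃ᵃⁱ[ℝ] Plane}
    (hT : IsOpen T) (hTb : Bornology.IsBounded T)
    (hΩ₁ : IsOpen Ω₁) (hb₁ : Bornology.IsBounded Ω₁)
    (hΩ₂ : IsOpen Ω₂) (hb₂ : Bornology.IsBounded Ω₂)
    (h₁ : IsTiledBy T Ω₁ φ₁ φ₂) (h₂ : IsTiledBy T Ω₂ ψ₁ ψ₂)
    (hUo : IsOpen U) (hUc : Convex ℝ U) (hUn : U.Nonempty) (hΓ : IsCompact Γ₂)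
    (hd : Disjoint Γ₂ U)
    (htr : ∀ u : Plane → ℝ, ContDiff ℝ (⊤ : ℕ∞) u → (∀ x ∈ Γ₁, u x = 0) →
      ∃ (v : Plane → ℝ) (L : ℝ≥0), LipschitzWith L v ∧ (∀ x ∉ U, v x = 0) ∧
        IsTransplant T φ₁ φ₂ ψ₁ ψ₂ u v)
    {k : ℕ} (hk : 1 ≤ k) {r : ℝ} (hr : r ∈ rayleighSups Ω₁ Γ₁ k) {η : ℝ} (hη : 0 < η) :
    ∃ r' ∈ rayleighSups Ω₂ Γ₂ k, r' ≤ r + η := by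
  have hr0 := nonneg_of_mem_rayleighSups hr
  obtain ⟨E, hfin, hadm, hinj, hrE⟩ := hr
  have : FiniteDimensional ℝ E := FiniteDimensional.of_finrank_pos (by omega)
  set e := Module.finBasisOfFinrankEq ℝ E hfin with he
  set u : Fin k → Plane → ℝ := fun i => (e i : Plane → ℝ) with hu
  have hus : ∀ i, ContDiff ℝ (⊤ : ℕ∞) (u i) := fun i => (hadm _ (e i).2).1
  have huΓ : ∀ i, ∀ x ∈ Γ₁, u i x = 0 := fun i x hx => by
    obtain ⟨V, -, hV, h0⟩ := (hadm _ (e i).2).2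
    exact h0 (hV hx)
  choose v L hvL hv0 hvt using fun i => htr (u i) (hus i) (huΓ i)
  choose w hws hwlim hwfd hwb hwdlim using fun i =>
    exists_smooth_approximation hUo hUc hUn hΓ hd (hvL i) (hv0 i)
  -- the quadratic forms of the original problem
  have hcomb : ∀ x : Fin k → ℝ, ((∑ i, x i • e i : E) : Plane → ℝ) = ∑ i, x i • u i := fun x => by
    simp [hu]
  have hB : ∀ x : Fin k → ℝ, x ≠ 0 →
      0 < ∑ i, ∑ j, x i * x j * ∫ p in Ω₁, ⟪u i p, u j p⟫ := fun x hx => by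
    rw [← setIntegral_sum_smul_sq hb₁ hus x, ← hcomb]
    refine setIntegral_sq_pos hΩ₁ hb₁ (hadm _ (Subtype.mem _)).1.continuous fun h0 => hx ?_
    have h1 := hinj _ (Subtype.mem _) h0
    have h2 : ∑ i, x i • e i = 0 := Subtype.ext h1
    funext i
    exact Fintype.linearIndependent_iff.1 e.linearIndependent x h2 i
  obtain ⟨C, hC⟩ := exists_quadratic_le (a := fun i j => ∫ p in Ω₁, ⟪∇ (u i) p, ∇ (u j) p⟫) hB
  have hA : ∀ x : Fin k → ℝ, ∑ i, ∑ j, x i * x j * ∫ p in Ω₁, ⟪∇ (u i) p, ∇ (u j) p⟫ ≤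
      r * ∑ i, ∑ j, x i * x j * ∫ p in Ω₁, ⟪u i p, u j p⟫ := fun x => by
    rcases eq_or_ne x 0 with rfl | hx
    · simp
    rw [← div_le_iff₀ (hB x hx), hrE]
    refine le_csSup ⟨C, ?_⟩ ⟨∑ i, x i • u i, ?_, ?_, ?_⟩
    · rintro q ⟨f, hfE, hf0, rfl⟩
      obtain ⟨y, hy⟩ : ∃ y : Fin k → ℝ, f = ∑ i, y i • u i :=
        ⟨e.repr ⟨f, hfE⟩, by rw [← hcomb, e.sum_repr]⟩
      have hy0 : y ≠ 0 := by
        rintro rfl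
        exact hf0 (by simpa using hy)
      rw [hy, setIntegral_sum_smul_sq hb₁ hus, setIntegral_norm_gradient_sum_smul_sq hb₁ hus,
        div_le_iff₀ (hB y hy0)]
      exact hC y
    · rw [← hcomb]
      exact Subtype.mem _
    · intro h0
      have := hB x hx
      rw [← setIntegral_sum_smul_sq hb₁ hus x, h0] at this
      simp at this
    · rw [setIntegral_sum_smul_sq hb₁ hus, setIntegral_norm_gradient_sum_smul_sq hb₁ hus]
  -- convergence of the quadratic forms of the smoothed transplants
  have hvb : ∀ i, ∃ M, ∀ n, ∀ p ∈ Ω₂, ‖w i n p‖ ≤ M := fun i => by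
    obtain ⟨c, hc⟩ := hwb i
    obtain ⟨M, hM⟩ := hb₂.isCompact_closure.exists_bound_of_continuousOn
      (f := fun p => |v i p| + 2 * L i * (‖p - c‖ + 1))
      (by have := (hvL i).continuous; fun_prop)
    refine ⟨M, fun n p hp => ?_⟩
    have h3 := (le_abs_self _).trans (hM p (subset_closure hp))
    have h4 := hc n p
    have h5 := abs_sub_abs_le_abs_sub (w i n p) (v i p)
    rw [Real.norm_eq_abs]
    linarith
  choose M hM using hvb
  have hBlim : ∀ i j, Tendsto (fun n => ∫ p in Ω₂, ⟪w i n p, w j n p⟫) atTop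
      (𝓝 (2 * ∫ p in Ω₁, ⟪u i p, u j p⟫)) := fun i j => by
    rw [← (hvt i).setIntegral_mul hT hTb h₁ h₂ (hvt j) (hus i).continuous (hus j).continuous]
    exact tendsto_setIntegral_inner hb₂ hΩ₂.measurableSet (fun n => (hws i n).1.continuous)
      (fun n => (hws j n).1.continuous) (hM i) (hM j) (ae_of_all _ (hwlim i))
      (ae_of_all _ (hwlim j))
  have hgrad : ∀ i, ∀ᵐ p ∂volume.restrict Ω₂,
      Tendsto (fun n => ∇ (w i n) p) atTop (𝓝 (∇ (v i) p)) := fun i => by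
    filter_upwards [(hvt i).ae_hasStrictFDerivAt hT hΩ₂.measurableSet h₂ (hus i)] with p hp
    exact ((InnerProductSpace.toDual ℝ Plane).symm.continuous.tendsto _).comp
      (hwdlim i p _ hp)
  have hgb : ∀ i n, ∀ p ∈ Ω₂, ‖∇ (w i n) p‖ ≤ 2 * L i := fun i n p _ => by
    simpa [gradient] using hwfd i n p
  have hAlim : ∀ i j, Tendsto (fun n => ∫ p in Ω₂, ⟪∇ (w i n) p, ∇ (w j n) p⟫) atTop
      (𝓝 (2 * ∫ p in Ω₁, ⟪∇ (u i) p, ∇ (u j) p⟫)) := fun i j => by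
    rw [← (hvt i).setIntegral_inner_gradient hT hTb h₁ h₂ (hvt j) (hus i) (hus j)]
    exact tendsto_setIntegral_inner hb₂ hΩ₂.measurableSet
      (fun n => (hws i n).1.continuous_gradient) (fun n => (hws j n).1.continuous_gradient)
      (hgb i) (hgb j) (hgrad i) (hgrad j)
  have hBev := eventually_quadratic_pos (fun x hx => by
    have h : ∑ i, ∑ j, x i * x j * (2 * ∫ p in Ω₁, ⟪u i p, u j p⟫) =
        2 * ∑ i, ∑ j, x i * x j * ∫ p in Ω₁, ⟪u i p, u j p⟫ := by
      simp only [Finset.mul_sum]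
      exact Finset.sum_congr rfl fun i _ => Finset.sum_congr rfl fun j _ => by ring
    rw [h]
    linarith [hB x hx]) hBlim
  have hlin : ∀ (s : ℝ) (x : Fin k → ℝ) (a b : Fin k → Fin k → ℝ),
      ∑ i, ∑ j, x i * x j * (s * b i j - a i j) =
        s * ∑ i, ∑ j, x i * x j * b i j - ∑ i, ∑ j, x i * x j * a i j := fun s x a b => by
    simp only [Finset.mul_sum, ← Finset.sum_sub_distrib]
    exact Finset.sum_congr rfl fun i _ => Finset.sum_congr rfl fun j _ => by ring
  have hQev := eventually_quadratic_pos
    (q := fun i j => (2 * (r + η)) * (∫ p in Ω₁, ⟪u i p, u j p⟫) -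
      2 * ∫ p in Ω₁, ⟪∇ (u i) p, ∇ (u j) p⟫)
    (qn := fun n i j => (r + η) * (∫ p in Ω₂, ⟪w i n p, w j n p⟫) -
      ∫ p in Ω₂, ⟪∇ (w i n) p, ∇ (w j n) p⟫) (fun x hx => by
    rw [hlin]
    have h : ∑ i, ∑ j, x i * x j * (2 * ∫ p in Ω₁, ⟪∇ (u i) p, ∇ (u j) p⟫) =
        2 * ∑ i, ∑ j, x i * x j * ∫ p in Ω₁, ⟪∇ (u i) p, ∇ (u j) p⟫ := by
      simp only [Finset.mul_sum]
      exact Finset.sum_congr rfl fun i _ => Finset.sum_congr rfl fun j _ => by ring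
    rw [h]
    nlinarith [hB x hx, hA x, mul_pos hη (hB x hx)])
    (fun i j => by
      have := ((hBlim i j).const_mul (r + η)).sub (hAlim i j)
      convert! this using 2
      ring)
  obtain ⟨n, hBn, hQn⟩ := (hBev.and hQev).exists
  -- the approximating space
  have hwn : ∀ i, ContDiff ℝ (⊤ : ℕ∞) (w i n) := fun i => (hws i n).1
  have hmem : ∀ f ∈ Submodule.span ℝ (range fun i => w i n),
      ∃ x : Fin k → ℝ, f = ∑ i, x i • w i n := fun f hf => by
    obtain ⟨x, hx⟩ := (Submodule.mem_span_range_iff_exists_fun ℝ).1 hf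
    exact ⟨x, hx.symm⟩
  have hzero : ∀ x : Fin k → ℝ, EqOn (∑ i, x i • w i n) 0 Ω₂ → x = 0 := fun x hx => by
    by_contra hx0
    have h1 := hBn x hx0
    rw [← setIntegral_sum_smul_sq hb₂ hwn x, setIntegral_congr_fun (g := fun _ => (0 : ℝ))
      hΩ₂.measurableSet (fun p hp => by simp only [hx hp]; simp)] at h1
    simp at h1
  have hli : LinearIndependent ℝ fun i => w i n :=
    Fintype.linearIndependent_iff.2 fun x hx i => by
      rw [hzero x (fun p _ => by rw [hx])]; rfl
  refine ⟨_, ⟨Submodule.span ℝ (range fun i => w i n), ?_, ?_, ?_, rfl⟩, ?_⟩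
  · simpa using finrank_span_eq_card hli
  · intro f hf
    obtain ⟨x, rfl⟩ := hmem f hf
    refine ⟨?_, ?_⟩
    · have : (∑ i, x i • w i n) = fun p => ∑ i, x i * w i n p := by
        ext p; simp
      rw [this]
      exact ContDiff.sum fun i _ => contDiff_const.mul (hwn i)
    · choose V hVo hV hV0 using fun i => (hws i n).2
      refine ⟨⋂ i, V i, isOpen_iInter_of_finite hVo, subset_iInter hV, fun p hp => ?_⟩
      have : ∀ i, w i n p = 0 := fun i => hV0 i (mem_iInter.1 hp i)
      simp [this]
  · intro f hf h0
    obtain ⟨x, rfl⟩ := hmem f hf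
    simp [hzero x h0]
  · refine Real.sSup_le ?_ (by linarith)
    rintro q ⟨f, hf, hf0, rfl⟩
    obtain ⟨x, rfl⟩ := hmem f hf
    have hx : x ≠ 0 := by
      rintro rfl
      exact hf0 (by simp)
    rw [setIntegral_sum_smul_sq hb₂ hwn, setIntegral_norm_gradient_sum_smul_sq hb₂ hwn,
      div_le_iff₀ (hBn x hx)]
    have := hQn x hx
    rw [hlin] at this
    linarith

end Comparison

section Lipschitz

open Filter Topology Set
open scoped NNReal

/-- `f` is Lipschitz with some constant. -/
def IsLipschitz {α β : Type*} [PseudoEMetricSpace α] [PseudoEMetricSpace β] (f : α → β) : Prop :=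
  ∃ K : ℝ≥0, LipschitzWith K f

namespace IsLipschitz

variable {f g : Plane → ℝ}

lemma coord (i : Fin 2) : IsLipschitz fun x : Plane => x i :=
  ⟨_, (EuclideanSpace.proj i : Plane →L[ℝ] ℝ).lipschitz⟩

lemma const (c : ℝ) : IsLipschitz fun _ : Plane => c := ⟨0, LipschitzWith.const c⟩

lemma add (hf : IsLipschitz f) (hg : IsLipschitz g) : IsLipschitz fun x => f x + g x :=
  let ⟨_, h⟩ := hf; let ⟨_, h'⟩ := hg; ⟨_, h.add h'⟩

lemma sub (hf : IsLipschitz f) (hg : IsLipschitz g) : IsLipschitz fun x => f x - g x :=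
  let ⟨_, h⟩ := hf; let ⟨_, h'⟩ := hg; ⟨_, h.sub h'⟩

lemma neg (hf : IsLipschitz f) : IsLipschitz fun x => -f x :=
  let ⟨_, h⟩ := hf; ⟨_, h.neg⟩

lemma max (hf : IsLipschitz f) (hg : IsLipschitz g) : IsLipschitz fun x => max (f x) (g x) :=
  let ⟨_, h⟩ := hf; let ⟨_, h'⟩ := hg; ⟨_, h.max h'⟩

lemma min (hf : IsLipschitz f) (hg : IsLipschitz g) : IsLipschitz fun x => min (f x) (g x) :=
  let ⟨_, h⟩ := hf; let ⟨_, h'⟩ := hg; ⟨_, h.min h'⟩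

lemma abs (hf : IsLipschitz f) : IsLipschitz fun x => |f x| := hf.max hf.neg

lemma div_const (hf : IsLipschitz f) (c : ℝ) : IsLipschitz fun x => f x / c := by
  obtain ⟨_, h⟩ := hf
  have h' := ((c⁻¹ • ContinuousLinearMap.id ℝ ℝ).lipschitz).comp h
  have e : (fun x => f x / c) = ⇑(c⁻¹ • ContinuousLinearMap.id ℝ ℝ) ∘ f := by
    ext x
    simp [div_eq_inv_mul]
  exact ⟨_, e ▸ h'⟩

lemma pt (hf : IsLipschitz f) (hg : IsLipschitz g) : IsLipschitz fun x => pt (f x) (g x) := by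
  obtain ⟨K, hf⟩ := hf
  obtain ⟨K', hg⟩ := hg
  have h : LipschitzWith (K ⊔ K') fun x => ![f x, g x] := by
    refine LipschitzWith.of_dist_le_mul fun x y => (dist_pi_le_iff (by positivity)).2 fun i => ?_
    fin_cases i
    · exact (hf.dist_le_mul x y).trans (by gcongr; exact le_sup_left)
    · exact (hg.dist_le_mul x y).trans (by gcongr; exact le_sup_right)
  exact ⟨_, (PiLp.lipschitzWith_toLp 2 fun _ : Fin 2 => ℝ).comp h⟩

end IsLipschitz

lemma exists_lipschitzOnWith_comp {u : Plane → ℝ} (hu : ContDiff ℝ (⊤ : ℕ∞) u)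
    {P : Plane → Plane} (hP : IsLipschitz P) {C : Set Plane} (hC : Bornology.IsBounded C) :
    ∃ K, LipschitzOnWith K (fun x => u (P x)) C := by
  obtain ⟨K, hP⟩ := hP
  obtain ⟨K', hK'⟩ := LocallyLipschitzOn.exists_lipschitzOnWith_of_compact
    (hP.isBounded_image hC).isCompact_closure
    ((hu.of_le (by simp)).locallyLipschitz.locallyLipschitzOn (s := closure (P '' C)))
  exact ⟨_, hK'.comp hP.lipschitzOnWith fun x hx => subset_closure (mem_image_of_mem P hx)⟩

/-- A Lipschitz function on `C` vanishing outside the open set `U ⊆ closure U ⊆ C` extends by zero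
from `U` to a Lipschitz function. -/
lemma lipschitzWith_indicator {U C : Set Plane} (hUC : closure U ⊆ C) {f : Plane → ℝ} {K : ℝ≥0}
    (hU : IsOpen U) (hf : LipschitzOnWith K f C) (h0 : ∀ x ∈ C, x ∉ U → f x = 0) :
    LipschitzWith K (U.indicator f) := by
  have hUC' : U ⊆ C := subset_closure.trans hUC
  have key : ∀ x ∈ U, ∀ y ∉ U, dist (f x) 0 ≤ K * dist x y := by
    intro x hx y hy
    obtain ⟨z, hz, hzC, hzU⟩ : ∃ z ∈ segment ℝ x y, z ∈ closure U ∧ z ∉ U := by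
      by_contra! hne
      obtain ⟨z, -, hzU, hzC⟩ := (convex_segment x y).isPreconnected U (closure U)ᶜ hU
        isClosed_closure.isOpen_compl (fun z hz => or_iff_not_imp_right.2 fun h =>
          hne z hz (not_not.1 h)) ⟨x, left_mem_segment ℝ x y, hx⟩
        ⟨y, right_mem_segment ℝ x y, fun h => hy (hne y (right_mem_segment ℝ x y) h)⟩
      exact hzC (subset_closure hzU)
    rw [← h0 z (hUC hzC) hzU]
    refine (hf.dist_le_mul x (hUC' hx) z (hUC hzC)).trans ?_
    gcongr
    have := dist_add_dist_of_mem_segment hz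
    linarith [dist_nonneg (x := z) (y := y)]
  refine LipschitzWith.of_dist_le_mul fun x y => ?_
  by_cases hx : x ∈ U <;> by_cases hy : y ∈ U
  · simpa [hx, hy] using hf.dist_le_mul x (hUC' hx) y (hUC' hy)
  · simpa [hx, hy] using key x hx y hy
  · rw [dist_comm, dist_comm x]
    simpa [hx, hy] using key y hy x hx
  · simp [hx, hy]
    positivity

end Lipschitz

section PlaneGeometry

open Filter Topology Set

@[simp] lemma pt_apply_zero (a b : ℝ) : pt a b 0 = a := rfl

@[simp] lemma pt_apply_one (a b : ℝ) : pt a b 1 = b := rfl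

lemma plane_ext {x y : Plane} (h0 : x 0 = y 0) (h1 : x 1 = y 1) : x = y := by
  ext i
  fin_cases i
  exacts [h0, h1]

lemma isBounded_of_coord_le {S : Set Plane} (R : ℝ) (h : ∀ x ∈ S, |x 0| ≤ R ∧ |x 1| ≤ R) :
    Bornology.IsBounded S := by
  refine (Metric.isBounded_closedBall (x := (0 : Plane)) (r := 2 * R)).subset fun x hx => ?_
  obtain ⟨h0, h1⟩ := h x hx
  have hR : 0 ≤ R := (abs_nonneg _).trans h0
  rw [mem_closedBall_zero_iff, EuclideanSpace.norm_eq, Fin.sum_univ_two]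
  refine Real.sqrt_le_iff.2 ⟨by positivity, ?_⟩
  simp only [Real.norm_eq_abs]
  nlinarith [abs_nonneg (x 0), abs_nonneg (x 1)]

lemma isCompact_segment_plane (x y : Plane) : IsCompact (segment ℝ x y) := by
  rw [segment_eq_image]
  exact isCompact_Icc.image (by fun_prop)

lemma volume_diagonal : volume {x : Plane | x 0 = x 1} = 0 := by
  let D : Submodule ℝ Plane := LinearMap.ker
    ((EuclideanSpace.proj 0 - EuclideanSpace.proj 1 : Plane →L[ℝ] ℝ) : Plane →ₗ[ℝ] ℝ)
  have hD : {x : Plane | x 0 = x 1} = D := by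
    ext x
    simp [D, sub_eq_zero]
  rw [hD]
  refine Measure.addHaar_submodule volume D fun h => ?_
  have : pt 1 0 ∈ D := by rw [h]; trivial
  rw [← SetLike.mem_coe, ← hD] at this
  simp at this

/-- The reflection `(x, y) ↦ (y, x)`. -/
noncomputable def reflection : Plane ≃ᵃⁱ[ℝ] Plane :=
  (LinearIsometryEquiv.piLpCongrLeft 2 ℝ ℝ (Equiv.swap (0 : Fin 2) 1)).toAffineIsometryEquiv

@[simp] lemma reflection_apply_zero (x : Plane) : reflection x 0 = x 1 := by
  simp [reflection, LinearIsometryEquiv.piLpCongrLeft_apply]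

@[simp] lemma reflection_apply_one (x : Plane) : reflection x 1 = x 0 := by
  simp [reflection, LinearIsometryEquiv.piLpCongrLeft_apply]

lemma isTiledBy_of_reflection_invariant {T Ω : Set Plane} {φ : Plane ≃ᵃⁱ[ℝ] Plane}
    (hφ : ∀ x, φ.symm x ∈ T ↔ x ∈ Ω ∧ x 1 < x 0) (hΩ : ∀ x, reflection x ∈ Ω ↔ x ∈ Ω) :
    IsTiledBy T Ω φ (φ.trans reflection) := by
  have hinv : ∀ x, reflection.symm x = reflection x := fun x => by
    rw [AffineIsometryEquiv.symm_apply_eq]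
    exact plane_ext (by simp) (by simp)
  have h1 : ∀ x, x ∈ φ '' T ↔ x ∈ Ω ∧ x 1 < x 0 := fun x => by
    rw [← hφ]
    exact ⟨by rintro ⟨y, hy, rfl⟩; simpa using hy, fun h => ⟨_, h, by simp⟩⟩
  have h2 : ∀ x, x ∈ (φ.trans reflection) '' T ↔ x ∈ Ω ∧ x 0 < x 1 := fun x => by
    have : x ∈ (φ.trans reflection) '' T ↔ reflection x ∈ φ '' T := by
      rw [← hinv]
      constructor
      · rintro ⟨y, hy, rfl⟩
        exact ⟨y, hy, by simp⟩
      · rintro ⟨y, hy, hyx⟩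
        exact ⟨y, hy, by simp [hyx]⟩
    rw [this, h1, hΩ]
    simp
  refine ⟨Set.disjoint_left.2 fun x hx hx' => ?_, ?_⟩
  · exact lt_asymm ((h1 x).1 hx).2 ((h2 x).1 hx').2
  · have hae : ∀ᵐ x : Plane, x 0 ≠ x 1 := measure_eq_zero_iff_ae_notMem.1 volume_diagonal
    filter_upwards [hae] with x hx
    refine propext ?_
    change (x ∈ φ '' T ∨ x ∈ (φ.trans reflection) '' T) ↔ x ∈ Ω
    rw [h1, h2]
    rcases lt_or_gt_of_ne hx with h | h <;> simp [h, h.not_gt]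

lemma interior_setOf_nonneg {l : Plane →L[ℝ] ℝ} (hl : l ≠ 0) (c : ℝ) :
    interior {x | c ≤ l x} = {x | c < l x} := by
  have hs : Function.Surjective l := 
    LinearMap.surjective (f := (l : Plane →ₗ[ℝ] ℝ)) fun h =>
      hl (ContinuousLinearMap.ext fun x => LinearMap.congr_fun h x)
  have := (l.isOpenMap hs).preimage_interior_eq_interior_preimage l.continuous (Ici c)
  rw [interior_Ici] at this
  exact this.symm

lemma convexHull_triangle (c : ℝ) (hc : 0 < c) :
    convexHull ℝ ({pt 0 0, pt c 0, pt 0 c} : Set Plane) =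
      {x | 0 ≤ x 0 ∧ 0 ≤ x 1 ∧ x 0 + x 1 ≤ c} := by
  apply Subset.antisymm
  · refine convexHull_min ?_ ?_
    · rintro x (rfl | rfl | rfl) <;> simp [hc.le]
    · rintro x ⟨hx0, hx1, hx⟩ y ⟨hy0, hy1, hy⟩ a b ha hb hab
      simp only [mem_ofPred_eq, PiLp.add_apply, PiLp.smul_apply, smul_eq_mul]
      refine ⟨by positivity, by positivity, ?_⟩
      have : a * (x 0 + x 1) + b * (y 0 + y 1) ≤ a * c + b * c := by gcongr
      have h3 : a * c + b * c = c := by rw [← add_mul, hab, one_mul]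
      linarith
  · rintro x ⟨hx0, hx1, hx⟩
    have hmem : ∀ i, (![pt 0 0, pt c 0, pt 0 c] : Fin 3 → Plane) i ∈
        convexHull ℝ ({pt 0 0, pt c 0, pt 0 c} : Set Plane) := fun i =>
      subset_convexHull ℝ _ (by fin_cases i <;> simp)
    have := (convex_convexHull ℝ ({pt 0 0, pt c 0, pt 0 c} : Set Plane)).sum_mem
      (t := Finset.univ) (w := ![1 - (x 0 + x 1) / c, x 0 / c, x 1 / c])
      (fun i _ => by
        fin_cases i
        · have : (x 0 + x 1) / c ≤ 1 := (div_le_one hc).2 hx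
          simpa using this
        · exact div_nonneg hx0 hc.le
        · exact div_nonneg hx1 hc.le)
      (by simp [Fin.sum_univ_three]; field_simp; ring) (fun i _ => hmem i)
    convert! this using 1
    refine plane_ext ?_ ?_ <;> simp [Fin.sum_univ_three] <;> field_simp

lemma rightTriangle_eq : rightTriangle = {x | 0 < x 0 ∧ 0 < x 1 ∧ x 0 + x 1 < √2} := by
  have hne : ∀ {l : Plane →L[ℝ] ℝ}, (l (pt 1 0) ≠ 0 ∨ l (pt 0 1) ≠ 0) → l ≠ 0 := by
    rintro l h rfl
    simp at h
  let p (i : Fin 2) : Plane →L[ℝ] ℝ := EuclideanSpace.proj i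
  have h0 := interior_setOf_nonneg (l := p 0) (hne (by simp [p])) 0
  have h1 := interior_setOf_nonneg (l := p 1) (hne (by simp [p])) 0
  have h2 := interior_setOf_nonneg (l := -(p 0 + p 1)) (hne (by simp [p])) (-√2)
  have e : {x : Plane | 0 ≤ x 0 ∧ 0 ≤ x 1 ∧ x 0 + x 1 ≤ √2} =
      {x | 0 ≤ p 0 x} ∩ ({x | 0 ≤ p 1 x} ∩ {x | -√2 ≤ (-(p 0 + p 1)) x}) := by
    ext x
    simp [p]
  rw [rightTriangle, convexHull_triangle _ (by positivity), e, interior_inter, interior_inter,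
    h0, h1, h2]
  ext x
  simp [p]

end PlaneGeometry

section SquareAndTriangle

open Filter Topology Set
open scoped NNReal

/-- The triangle with vertices `(0, 0)`, `(1, 0)`, `(1, 1)`, two copies of which tile both the
unit square and the right triangle. -/
def halfSquare : Set Plane := {x | 0 < x 1 ∧ x 1 < x 0 ∧ x 0 < 1}

lemma isOpen_halfSquare : IsOpen halfSquare := by
  refine .and ?_ (.and ?_ ?_) <;> exact isOpen_lt (by fun_prop) (by fun_prop)

lemma isBounded_halfSquare : Bornology.IsBounded halfSquare :=
  isBounded_of_coord_le 1 fun x ⟨h0, h1, h2⟩ => by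
    constructor <;> rw [abs_le] <;> constructor <;> linarith

lemma isOpen_unitSquare : IsOpen unitSquare :=
  (isOpen_Ioo.preimage (by fun_prop : Continuous fun x : Plane => x 0)).inter
    (isOpen_Ioo.preimage (by fun_prop : Continuous fun x : Plane => x 1))

lemma isBounded_unitSquare : Bornology.IsBounded unitSquare :=
  isBounded_of_coord_le 1 fun x ⟨⟨h0, h1⟩, h2, h3⟩ => by
    constructor <;> rw [abs_le] <;> constructor <;> linarith

lemma isBounded_rightTriangle : Bornology.IsBounded rightTriangle := by
  rw [rightTriangle_eq]
  refine isBounded_of_coord_le √2 fun x ⟨h0, h1, h2⟩ => ?_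
  constructor <;> rw [abs_le] <;> constructor <;> linarith

/-- The linear isometry `(x, y) ↦ (-(x + y) / √2, (x - y) / √2)`. -/
noncomputable def diagonalIsometry : Plane →ₗᵢ[ℝ] Plane where
  toFun x := pt (-(x 0 + x 1) / √2) ((x 0 - x 1) / √2)
  map_add' x y := plane_ext (by simp; ring) (by simp; ring)
  map_smul' c x := plane_ext (by simp; ring) (by simp; ring)
  norm_map' x := by
    have h2 : √2 ^ 2 = 2 := Real.sq_sqrt (by norm_num)
    rw [EuclideanSpace.norm_eq, EuclideanSpace.norm_eq]
    congr 1
    simp [Fin.sum_univ_two, div_pow, h2]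
    ring

/-- The isometry carrying `halfSquare` to the half of the right triangle below the diagonal. -/
noncomputable def toTriangle : Plane ≃ᵃⁱ[ℝ] Plane :=
  (diagonalIsometry.toLinearIsometryEquiv rfl).toAffineIsometryEquiv.trans
    (AffineIsometryEquiv.constVAdd ℝ Plane (pt √2 0))

lemma toTriangle_apply_zero (x : Plane) : toTriangle x 0 = (2 - x 0 - x 1) / √2 := by
  have h : toTriangle x 0 = √2 + -(x 0 + x 1) / √2 := rfl
  have h2 : √2 * √2 = 2 := Real.mul_self_sqrt (by norm_num)
  rw [h]
  field_simp
  linarith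

lemma toTriangle_apply_one (x : Plane) : toTriangle x 1 = (x 0 - x 1) / √2 := by
  have h : toTriangle x 1 = 0 + (x 0 - x 1) / √2 := rfl
  rw [h, zero_add]

lemma eq_pt (x : Plane) : x = pt (x 0) (x 1) := plane_ext rfl rfl

lemma reflection_eq (x : Plane) : reflection x = pt (x 1) (x 0) :=
  plane_ext (by simp) (by simp)

lemma isTiledBy_unitSquare :
    IsTiledBy halfSquare unitSquare (.refl ℝ Plane) ((AffineIsometryEquiv.refl ℝ Plane).trans
      reflection) := by
  refine isTiledBy_of_reflection_invariant (fun x => ?_) fun x => ?_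
  · change (0 < x 1 ∧ x 1 < x 0 ∧ x 0 < 1) ↔ ((0 < x 0 ∧ x 0 < 1) ∧ 0 < x 1 ∧ x 1 < 1) ∧ x 1 < x 0
    grind
  · simp [unitSquare, and_comm]

lemma isTiledBy_rightTriangle :
    IsTiledBy halfSquare rightTriangle toTriangle (toTriangle.trans reflection) := by
  have h2 : √2 * √2 = 2 := Real.mul_self_sqrt (by norm_num)
  have hpos : 0 < √2 := by positivity
  refine isTiledBy_of_reflection_invariant (fun x => ?_) fun x => ?_
  · obtain ⟨y, rfl⟩ := toTriangle.surjective x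
    rw [AffineIsometryEquiv.symm_apply_apply, rightTriangle_eq]
    change (0 < y 1 ∧ y 1 < y 0 ∧ y 0 < 1) ↔ (_ ∧ _ ∧ _) ∧ _
    rw [toTriangle_apply_zero, toTriangle_apply_one, ← add_div, div_lt_iff₀ hpos, h2,
      div_lt_div_iff_of_pos_right hpos, div_pos_iff_of_pos_right hpos, div_pos_iff_of_pos_right hpos]
    grind
  · rw [rightTriangle_eq]
    simp only [mem_ofPred_eq, reflection_apply_zero, reflection_apply_one]
    grind

lemma isCompact_squareDirichlet : IsCompact squareDirichlet :=
  ((isCompact_segment_plane _ _).union (isCompact_segment_plane _ _)).union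
    (isCompact_segment_plane _ _)

lemma isCompact_triangleDirichlet : IsCompact triangleDirichlet :=
  (isCompact_segment_plane _ _).union (isCompact_segment_plane _ _)

lemma pt_zero_left_mem_squareDirichlet {t : ℝ} (h0 : 0 ≤ t) (h1 : t ≤ 1) :
    pt 0 t ∈ squareDirichlet :=
  .inl (.inl ⟨1 - t, t, by linarith, h0, by ring, plane_ext (by simp) (by simp)⟩)

lemma pt_zero_right_mem_squareDirichlet {t : ℝ} (h0 : 0 ≤ t) (h1 : t ≤ 1) :
    pt t 0 ∈ squareDirichlet :=
  .inl (.inr ⟨1 - t, t, by linarith, h0, by ring, plane_ext (by simp) (by simp)⟩)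

lemma pt_one_left_mem_squareDirichlet {t : ℝ} (h0 : 0 ≤ t) (h1 : t ≤ 1) :
    pt 1 t ∈ squareDirichlet :=
  .inr ⟨1 - t, t, by linarith, h0, by ring, plane_ext (by simp) (by simp)⟩

/-- The point of the plane with coordinates `s`, `d` along the diagonal directions. -/
noncomputable def diagPt (s d : ℝ) : Plane := pt ((s + d) / √2) ((s - d) / √2)

lemma toTriangle_eq_diagPt (x : Plane) : toTriangle x = diagPt (1 - x 1) (1 - x 0) :=
  plane_ext (by rw [toTriangle_apply_zero]; simp [diagPt]; ring)
    (by rw [toTriangle_apply_one]; simp [diagPt])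

lemma reflection_toTriangle_eq_diagPt (x : Plane) :
    reflection (toTriangle x) = diagPt (1 - x 1) (x 0 - 1) :=
  plane_ext (by rw [reflection_apply_zero, toTriangle_apply_one]; simp [diagPt])
    (by rw [reflection_apply_one, toTriangle_apply_zero]; simp [diagPt]; ring)

lemma diagPt_one_mem_triangleDirichlet {d : ℝ} (h0 : -1 ≤ d) (h1 : d ≤ 1) :
    diagPt 1 d ∈ triangleDirichlet := by
  have h2 : √2 * √2 = 2 := Real.mul_self_sqrt (by norm_num)
  refine .inl ⟨(1 + d) / 2, (1 - d) / 2, by linarith, by linarith, by ring, plane_ext ?_ ?_⟩ <;>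
    (simp [diagPt]; field_simp; grind)

lemma diagPt_neg_mem_triangleDirichlet {s : ℝ} (h0 : 0 ≤ s) (h1 : s ≤ 1) :
    diagPt s (-s) ∈ triangleDirichlet := by
  have h2 : √2 * √2 = 2 := Real.mul_self_sqrt (by norm_num)
  refine .inr ⟨1 - s, s, by linarith, h0, by ring, plane_ext ?_ ?_⟩ <;>
    simp [diagPt]
  field_simp
  grind

/-- The union of the right triangle, its mirror image in its bottom leg, and their common leg. -/
def doubledTriangle : Set Plane := {x | 0 < x 0 ∧ x 0 + x 1 < √2 ∧ x 0 - x 1 < √2}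

/-- The union of the unit square, its mirror image in its top side, and their common side. -/
def doubledSquare : Set Plane := {x | (0 < x 0 ∧ x 0 < 1) ∧ 0 < x 1 ∧ x 1 < 2}

lemma isOpen_doubledTriangle : IsOpen doubledTriangle := by
  refine .and ?_ (.and ?_ ?_) <;> exact isOpen_lt (by fun_prop) (by fun_prop)

lemma isOpen_doubledSquare : IsOpen doubledSquare :=
  (isOpen_Ioo.preimage (by fun_prop : Continuous fun x : Plane => x 0)).inter
    (isOpen_Ioo.preimage (by fun_prop : Continuous fun x : Plane => x 1))

lemma isLinearMap_coord (i : Fin 2) : IsLinearMap ℝ fun x : Plane => x i :=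
  ⟨fun _ _ => by simp, fun _ _ => by simp⟩

lemma convex_doubledTriangle : Convex ℝ doubledTriangle :=
  (convex_halfSpace_gt (isLinearMap_coord 0) _).inter
    ((convex_halfSpace_lt (f := fun x : Plane => x 0 + x 1)
      ⟨fun _ _ => by simp; ring, fun _ _ => by simp; ring⟩ _).inter
    (convex_halfSpace_lt (f := fun x : Plane => x 0 - x 1)
      ⟨fun _ _ => by simp; ring, fun _ _ => by simp; ring⟩ _))

lemma convex_doubledSquare : Convex ℝ doubledSquare :=
  ((convex_halfSpace_gt (isLinearMap_coord 0) _).inter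
    (convex_halfSpace_lt (isLinearMap_coord 0) _)).inter
  ((convex_halfSpace_gt (isLinearMap_coord 1) _).inter
    (convex_halfSpace_lt (isLinearMap_coord 1) _))

lemma disjoint_triangleDirichlet : Disjoint triangleDirichlet doubledTriangle := by
  refine Set.disjoint_left.2 ?_
  rintro _ (⟨a, b, ha, hb, hab, rfl⟩ | ⟨a, b, ha, hb, hab, rfl⟩) ⟨h0, h1, h2⟩
  · simp [← add_mul, hab] at h1
  · simp at h0

lemma disjoint_squareDirichlet : Disjoint squareDirichlet doubledSquare := by
  refine Set.disjoint_left.2 ?_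
  rintro _ ((⟨a, b, ha, hb, hab, rfl⟩ | ⟨a, b, ha, hb, hab, rfl⟩) | ⟨a, b, ha, hb, hab, rfl⟩)
    ⟨⟨h0, h1⟩, h2, h3⟩
  · simp at h0
  · simp at h2
  · simp [hab] at h1

lemma exists_lipschitzWith_indicator {u : Plane → ℝ} (hu : ContDiff ℝ (⊤ : ℕ∞) u) {U C : Set Plane}
    (hU : IsOpen U) (hUC : closure U ⊆ C) (hC : Bornology.IsBounded C) {P₁ P₂ P₃ : Plane → Plane}
    (h₁ : IsLipschitz P₁) (h₂ : IsLipschitz P₂) (h₃ : IsLipschitz P₃)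
    (h0 : ∀ x ∈ C, x ∉ U → u (P₁ x) + u (P₂ x) - u (P₃ x) = 0) :
    ∃ L, LipschitzWith L (U.indicator fun x => u (P₁ x) + u (P₂ x) - u (P₃ x)) := by
  obtain ⟨K₁, hK₁⟩ := exists_lipschitzOnWith_comp hu h₁ hC
  obtain ⟨K₂, hK₂⟩ := exists_lipschitzOnWith_comp hu h₂ hC
  obtain ⟨K₃, hK₃⟩ := exists_lipschitzOnWith_comp hu h₃ hC
  exact ⟨_, lipschitzWith_indicator hUC hU ((hK₁.add hK₂).sub hK₃) h0⟩

lemma exists_transplant_unitSquare_rightTriangle {u : Plane → ℝ} (hu : ContDiff ℝ (⊤ : ℕ∞) u)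
    (h0 : ∀ x ∈ squareDirichlet, u x = 0) :
    ∃ (v : Plane → ℝ) (L : ℝ≥0), LipschitzWith L v ∧ (∀ x ∉ doubledTriangle, v x = 0) ∧
      IsTransplant halfSquare (.refl ℝ Plane) ((AffineIsometryEquiv.refl ℝ Plane).trans reflection)
        toTriangle (toTriangle.trans reflection) u v := by
  have hpos : 0 < √2 := by positivity
  have h2 : √2 * √2 = 2 := Real.mul_self_sqrt (by norm_num)
  let C : Set Plane := {x | 0 ≤ x 0 ∧ x 0 + x 1 ≤ √2 ∧ x 0 - x 1 ≤ √2}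
  have hCc : IsClosed C := by
    simp only [C, ofPred_and]
    refine .inter ?_ (.inter ?_ ?_) <;> exact isClosed_le (by fun_prop) (by fun_prop)
  have hUC : closure doubledTriangle ⊆ C :=
    closure_minimal (fun x ⟨h0, h1, h2⟩ => ⟨h0.le, h1.le, h2.le⟩) hCc
  have hCb : Bornology.IsBounded C := isBounded_of_coord_le √2 fun x ⟨h0, h1, h2⟩ => by
    constructor <;> rw [abs_le] <;> constructor <;> linarith
  let s : Plane → ℝ := fun x => (x 0 + |x 1|) / √2
  let d : Plane → ℝ := fun x => (x 0 - |x 1|) / √2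
  have hs : IsLipschitz s := ((IsLipschitz.coord 0).add (IsLipschitz.coord 1).abs).div_const _
  have hd : IsLipschitz d := ((IsLipschitz.coord 0).sub (IsLipschitz.coord 1).abs).div_const _
  have h1s : IsLipschitz fun x => 1 - s x := (IsLipschitz.const 1).sub hs
  obtain ⟨L, hL⟩ := exists_lipschitzWith_indicator hu isOpen_doubledTriangle hUC hCb
    (P₁ := fun x => pt (1 - s x) (1 - |d x|)) (P₂ := fun x => pt (1 - max (d x) 0) (1 - s x))
    (P₃ := fun x => pt (1 - max (-d x) 0) (1 - s x))
    (h1s.pt ((IsLipschitz.const 1).sub hd.abs))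
    (((IsLipschitz.const 1).sub (hd.max (.const 0))).pt h1s)
    (((IsLipschitz.const 1).sub (hd.neg.max (.const 0))).pt h1s) fun x ⟨hx0, hx1, hx2⟩ hx => by
      have habs : x 0 + |x 1| ≤ √2 := by rcases abs_cases (x 1) with h | h <;> linarith
      have hs0 : 0 ≤ s x := by positivity
      have hs1 : s x ≤ 1 := (div_le_one hpos).2 habs
      have hds : d x ≤ s x := by
        simp only [s, d]
        gcongr
        linarith [abs_nonneg (x 1)]
      have hds' : -s x ≤ d x := by
        simp only [s, d, ← neg_div]
        gcongr
        linarith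
      by_cases h : x 0 = 0
      · have hd : d x = -s x := by simp only [s, d, h]; ring
        rw [hd, abs_neg, neg_neg, abs_of_nonneg hs0, max_eq_left hs0, max_eq_right (by linarith),
          sub_zero, h0 _ (pt_one_left_mem_squareDirichlet (by linarith) (by linarith))]
        ring
      · have hs : s x = 1 := by
          rw [div_eq_one_iff_eq hpos.ne']
          by_contra h'
          refine hx ⟨lt_of_le_of_ne hx0 (Ne.symm h), ?_, ?_⟩ <;>
            linarith [lt_of_le_of_ne habs h', le_abs_self (x 1), neg_le_abs (x 1)]
        rw [hs] at hds hds' ⊢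
        have := abs_le.2 ⟨hds', hds⟩
        rw [sub_self, h0 _ (pt_zero_left_mem_squareDirichlet (by linarith) (by simp)),
          h0 _ (pt_zero_right_mem_squareDirichlet _ _),
          h0 _ (pt_zero_right_mem_squareDirichlet _ _)] <;> grind
  have key : ∀ σ δ : ℝ, -σ < δ → δ < σ → σ < 1 →
      doubledTriangle.indicator (fun x => u (pt (1 - s x) (1 - |d x|)) +
        u (pt (1 - max (d x) 0) (1 - s x)) - u (pt (1 - max (-d x) 0) (1 - s x))) (diagPt σ δ) =
      u (pt (1 - σ) (1 - |δ|)) + u (pt (1 - max δ 0) (1 - σ)) - u (pt (1 - max (-δ) 0) (1 - σ)) := by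
    intro σ δ h₁ h₂ h₃
    have habs : |diagPt σ δ 1| = (σ - δ) / √2 :=
      abs_of_nonneg (div_nonneg (by linarith) hpos.le)
    have hsσ : s (diagPt σ δ) = σ := by
      simp only [s, habs]
      simp only [diagPt, pt_apply_zero]
      field_simp
      linear_combination -σ * h2
    have hdδ : d (diagPt σ δ) = δ := by
      simp only [d, habs]
      simp only [diagPt, pt_apply_zero]
      field_simp
      linear_combination -δ * h2
    rw [indicator_of_mem, hsσ, hdδ]
    refine ⟨div_pos (by linarith) hpos, ?_, ?_⟩ <;>
      simp only [diagPt, pt_apply_zero, pt_apply_one, ← add_div, ← sub_div] <;>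
      rw [div_lt_iff₀ hpos] <;> linarith
  refine ⟨_, L, hL, fun x hx => indicator_of_notMem hx _,
    ⟨fun x ⟨h₁, h₂, h₃⟩ => ?_, fun x ⟨h₁, h₂, h₃⟩ => ?_⟩⟩
  · change indicator _ _ (toTriangle x) = u x + u (reflection x)
    rw [toTriangle_eq_diagPt, key _ _ (by linarith) (by linarith) (by linarith),
      abs_of_pos (by linarith), max_eq_left (by linarith), max_eq_right (by linarith),
      sub_zero, h0 _ (pt_one_left_mem_squareDirichlet (by linarith) (by linarith)), reflection_eq]
    simp [add_comm, ← eq_pt]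
  · change indicator _ _ (reflection (toTriangle x)) = u (reflection x) - u x
    rw [reflection_toTriangle_eq_diagPt, key _ _ (by linarith) (by linarith) (by linarith),
      abs_of_neg (by linarith), max_eq_right (by linarith), max_eq_left (by linarith),
      sub_zero, h0 _ (pt_one_left_mem_squareDirichlet (by linarith) (by linarith)), reflection_eq]
    simp [← eq_pt]

lemma exists_transplant_rightTriangle_unitSquare {u : Plane → ℝ} (hu : ContDiff ℝ (⊤ : ℕ∞) u)
    (h0 : ∀ x ∈ triangleDirichlet, u x = 0) :
    ∃ (v : Plane → ℝ) (L : ℝ≥0), LipschitzWith L v ∧ (∀ x ∉ doubledSquare, v x = 0) ∧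
      IsTransplant halfSquare (toTriangle.trans reflection) toTriangle
        ((AffineIsometryEquiv.refl ℝ Plane).trans reflection) (.refl ℝ Plane) u v := by
  let C : Set Plane := {x | (0 ≤ x 0 ∧ x 0 ≤ 1) ∧ 0 ≤ x 1 ∧ x 1 ≤ 2}
  have hCc : IsClosed C := by
    simp only [C, ofPred_and]
    refine .inter (.inter ?_ ?_) (.inter ?_ ?_) <;> exact isClosed_le (by fun_prop) (by fun_prop)
  have hUC : closure doubledSquare ⊆ C :=
    closure_minimal (fun x ⟨⟨h0, h1⟩, h2, h3⟩ => ⟨⟨h0.le, h1.le⟩, h2.le, h3.le⟩) hCc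
  have hCb : Bornology.IsBounded C := isBounded_of_coord_le 2 fun x ⟨⟨h0, h1⟩, h2, h3⟩ => by
    constructor <;> rw [abs_le] <;> constructor <;> linarith
  let X : Plane → ℝ := fun x => x 0
  let Y : Plane → ℝ := fun x => 1 - |1 - x 1|
  have hX : IsLipschitz X := .coord 0
  have hY : IsLipschitz Y := (IsLipschitz.const 1).sub ((IsLipschitz.const 1).sub (.coord 1)).abs
  have hM : IsLipschitz fun x => max (X x) (Y x) - 1 := (hX.max hY).sub (.const 1)
  have hQ {f g : Plane → ℝ} (hf : IsLipschitz f) (hg : IsLipschitz g) :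
      IsLipschitz fun x => diagPt (f x) (g x) :=
    ((hf.add hg).div_const _).pt ((hf.sub hg).div_const _)
  have hleg : ∀ t, 0 ≤ t → t ≤ 1 → u (diagPt (1 - t) (t - 1)) = 0 := fun t h h' => by
    have := diagPt_neg_mem_triangleDirichlet (s := 1 - t) (by linarith) (by linarith)
    rw [neg_sub] at this
    exact h0 _ this
  obtain ⟨L, hL⟩ := exists_lipschitzWith_indicator hu isOpen_doubledSquare hUC hCb
    (P₁ := fun x => diagPt (1 - min (X x) (Y x)) (1 - max (X x) (Y x)))
    (P₂ := fun x => diagPt (1 - X x) (max (X x) (Y x) - 1))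
    (P₃ := fun x => diagPt (1 - Y x) (max (X x) (Y x) - 1))
    (hQ ((IsLipschitz.const 1).sub (hX.min hY)) ((IsLipschitz.const 1).sub (hX.max hY)))
    (hQ ((IsLipschitz.const 1).sub hX) hM)
    (hQ ((IsLipschitz.const 1).sub hY) hM) fun x ⟨⟨hx0, hx1⟩, hx2, hx3⟩ hx => by
      have hX0 : 0 ≤ X x := hx0
      have hX1 : X x ≤ 1 := hx1
      have hY0 : 0 ≤ Y x := sub_nonneg.2 (abs_le.2 ⟨by linarith, by linarith⟩)
      have hY1 : Y x ≤ 1 := sub_le_self _ (abs_nonneg _)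
      have hcase : X x = 0 ∨ X x = 1 ∨ Y x = 0 := by
        by_contra! h
        have habs : |1 - x 1| < 1 := sub_pos.1 (lt_of_le_of_ne hY0 h.2.2.symm)
        rw [abs_lt] at habs
        exact hx ⟨⟨lt_of_le_of_ne hX0 h.1.symm, lt_of_le_of_ne hX1 h.2.1⟩, by linarith, by linarith⟩
      have hhyp : ∀ t, -1 ≤ t → t ≤ 1 → u (diagPt 1 t) = 0 := fun t h h' =>
        h0 _ (diagPt_one_mem_triangleDirichlet h h')
      rcases hcase with h | h | h
      · rw [h, min_eq_left hY0, max_eq_right hY0, sub_zero, hhyp _ (by linarith) (by linarith),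
          hhyp _ (by linarith) (by linarith), hleg _ hY0 hY1]
        ring
      · have := hleg 1 zero_le_one le_rfl
        rw [h, min_eq_right hY1, max_eq_left hY1, this]
        simp
      · rw [h, min_eq_right hX0, max_eq_left hX0, sub_zero, hhyp _ (by linarith) (by linarith),
          hhyp _ (by linarith) (by linarith), hleg _ hX0 hX1]
        ring
  have key : ∀ X' Y' : ℝ, 0 < X' → X' < 1 → 0 < Y' → Y' < 1 →
      doubledSquare.indicator (fun x => u (diagPt (1 - min (X x) (Y x)) (1 - max (X x) (Y x))) +
        u (diagPt (1 - X x) (max (X x) (Y x) - 1)) - u (diagPt (1 - Y x) (max (X x) (Y x) - 1)))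
        (pt X' Y') =
      u (diagPt (1 - min X' Y') (1 - max X' Y')) +
        u (diagPt (1 - X') (max X' Y' - 1)) - u (diagPt (1 - Y') (max X' Y' - 1)) := by
    intro X' Y' h₁ h₂ h₃ h₄
    have hY' : Y (pt X' Y') = Y' := by
      simp only [Y, pt_apply_one]
      rw [abs_of_pos (by linarith)]
      ring
    have hmem : pt X' Y' ∈ doubledSquare := ⟨⟨h₁, h₂⟩, h₃, by rw [pt_apply_one]; linarith⟩
    rw [indicator_of_mem hmem, hY']
    rfl
  refine ⟨_, L, hL, fun x hx => indicator_of_notMem hx _,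
    ⟨fun x ⟨h₁, h₂, h₃⟩ => ?_, fun x ⟨h₁, h₂, h₃⟩ => ?_⟩⟩
  · change indicator _ _ (reflection x) = u (reflection (toTriangle x)) + u (toTriangle x)
    rw [reflection_eq x, key _ _ h₁ (by linarith) (by linarith) h₃, min_eq_left h₂.le,
      max_eq_right h₂.le, hleg _ (by linarith) h₃.le, reflection_toTriangle_eq_diagPt,
      toTriangle_eq_diagPt]
    ring
  · change indicator _ _ x = u (toTriangle x) - u (reflection (toTriangle x))
    rw [reflection_toTriangle_eq_diagPt, toTriangle_eq_diagPt, eq_pt x,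
      key _ _ (by linarith) h₃ h₁ (by linarith), min_eq_right h₂.le, max_eq_left h₂.le,
      hleg _ (by linarith) h₃.le]
    simp

end SquareAndTriangle
/-- isospectral domains with mixed Dirichlet–Neumann boundary conditions:
the unit square, with Dirichlet conditions on its left, bottom and right sides, and the right
isosceles triangle with vertices `(0,0)`, `(√2,0)`, `(0,√2)`, with Dirichlet conditions on its
hypotenuse and vertical leg, are isospectral for the mixed eigenvalue problem. -/
theorem mixed_dirichlet_neumann_isospectral :
    ∀ k : ℕ, 1 ≤ k →
      mixedEig unitSquare squareDirichlet k = mixedEig rightTriangle triangleDirichlet k := by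
  intro k hk
  have ht := isOpen_interior (s := convexHull ℝ ({pt 0 0, pt √2 0, pt 0 √2} : Set Plane))
  exact mixedEig_eq_of_forall_exists_le_add
    (fun r hr η hη => exists_mem_rayleighSups_le_add isOpen_halfSquare isBounded_halfSquare
      isOpen_unitSquare isBounded_unitSquare ht isBounded_rightTriangle
      isTiledBy_unitSquare isTiledBy_rightTriangle
      isOpen_doubledTriangle convex_doubledTriangle ⟨pt (√2 / 2) 0, by
        simp [doubledTriangle]⟩ isCompact_triangleDirichlet disjoint_triangleDirichlet
      (fun _ => exists_transplant_unitSquare_rightTriangle) hk hr hη)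
    (fun r hr η hη => exists_mem_rayleighSups_le_add isOpen_halfSquare isBounded_halfSquare
      ht isBounded_rightTriangle isOpen_unitSquare isBounded_unitSquare
      isTiledBy_rightTriangle.symm isTiledBy_unitSquare.symm
      isOpen_doubledSquare convex_doubledSquare ⟨pt (1 / 2) 1, by
        norm_num [doubledSquare]⟩ isCompact_squareDirichlet disjoint_squareDirichlet
      (fun _ => exists_transplant_rightTriangle_unitSquare) hk hr hη)
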